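/- arXiv:2206.12570 — 2 statements merged into one kernel-verified Lean document; each statement's English description precedes it below -/
import Mathlib

section
/- For every $p \in (1,\infty)$ and every weight $w \in A_p$ on $\mathbb{R}^n$, the Hardy–Littlewood maximal operator satisfies $\|M\|_{L^p(w) \to L^p(w)} \le 2^n \cdot 3^{n(\frac{p}{p-1} + \frac{6}{p})} [w]_{A_p}^{1/(p-1)}$. -/
open MeasureTheory ENNReal

noncomputable section

/-- A (closed, axis-parallel) cube in `ℝⁿ`. -/
def IsCube {n : ℕ} (Q : Set (Fin n → ℝ)) : Prop :=
  ∃ (c : Fin n → ℝ) (r : ℝ), 0 < r ∧ Q = {x | ∀ i, |x i - c i| ≤ r}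

/-- Average `⨍_Q w` of an `ℝ≥0∞`-valued function over a set. -/
def avgE {n : ℕ} (Q : Set (Fin n → ℝ)) (w : (Fin n → ℝ) → ℝ≥0∞) : ℝ≥0∞ :=
  (∫⁻ x in Q, w x) / volume Q

/-- The `A_p` constant, `1 < p < ∞`. -/
def apSup {n : ℕ} (p : ℝ) (w : (Fin n → ℝ) → ℝ≥0∞) : ℝ≥0∞ :=
  ⨆ (Q : Set (Fin n → ℝ)) (_ : IsCube Q),
    avgE Q w * (avgE Q fun x => w x ^ (-(1 / (p - 1)))) ^ (p - 1)

/-- The `A_1` constant. -/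
def a1Const {n : ℕ} (w : (Fin n → ℝ) → ℝ≥0∞) : ℝ≥0∞ :=
  ⨆ (Q : Set (Fin n → ℝ)) (_ : IsCube Q),
    avgE Q w * essSup (fun x => (w x)⁻¹) (volume.restrict Q)

/-- The Muckenhoupt `A_p` constant for `1 ≤ p < ∞`. -/
def apConst {n : ℕ} (p : ℝ) (w : (Fin n → ℝ) → ℝ≥0∞) : ℝ≥0∞ :=
  if p = 1 then a1Const w else apSup p w

/-- The `A_∞` constant, `[w]_{A_∞} = inf_{p>1} [w]_{A_p}`. -/
def aInftyConst {n : ℕ} (w : (Fin n → ℝ) → ℝ≥0∞) : ℝ≥0∞ :=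
  ⨅ (p : ℝ) (_ : 1 < p), apConst p w

/-- The reverse Hölder constant, `1 ≤ s < ∞`. -/
def rhConst {n : ℕ} (s : ℝ) (w : (Fin n → ℝ) → ℝ≥0∞) : ℝ≥0∞ :=
  ⨆ (Q : Set (Fin n → ℝ)) (_ : IsCube Q),
    (avgE Q fun x => w x ^ s) ^ (1 / s) / avgE Q w

/-- The reverse Hölder constant for an exponent `s ∈ [1,∞]`. -/
def rhConstE {n : ℕ} (s : ℝ≥0∞) (w : (Fin n → ℝ) → ℝ≥0∞) : ℝ≥0∞ :=
  if s = ∞ then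
    ⨆ (Q : Set (Fin n → ℝ)) (_ : IsCube Q),
      essSup w (volume.restrict Q) / avgE Q w
  else rhConst s.toReal w

/-- A weight on `ℝⁿ`: measurable, positive and finite a.e. -/
def IsWeight {n : ℕ} (w : (Fin n → ℝ) → ℝ≥0∞) : Prop :=
  Measurable w ∧ ∀ᵐ x ∂(volume : Measure (Fin n → ℝ)), 0 < w x ∧ w x < ∞

/-- The conjugate exponent `p' = p/(p-1)` of a real exponent. -/
def rconj (p : ℝ) : ℝ := p / (p - 1)

/-- The conjugate exponent of an extended-real exponent, with `1' = ∞`, `∞' = 1`. -/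
def econj (p : ℝ≥0∞) : ℝ≥0∞ :=
  if p = ∞ then 1 else if p ≤ 1 then ∞ else ENNReal.ofReal (p.toReal / (p.toReal - 1))

/-- The limited-range exponent `τ_p = (𝔭₊/p)'(p/𝔭₋ - 1) + 1`. -/
def tauExp (pm : ℝ) (pp : ℝ≥0∞) (p : ℝ) : ℝ :=
  (econj (pp / ENNReal.ofReal p)).toReal * (p / pm - 1) + 1

/-- The (uncentered) Hardy–Littlewood maximal function over cubes. -/
def maximalFn {n : ℕ} (f : (Fin n → ℝ) → ℝ≥0∞) (x : Fin n → ℝ) : ℝ≥0∞ :=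
  ⨆ (Q : Set (Fin n → ℝ)) (_ : IsCube Q) (_ : x ∈ Q), avgE Q f

open Set in
lemma weak_union {X ι : Type*} [MeasurableSpace X] [DecidableEq ι] (μ ν : Measure X) (Q : ι → Set X)
    (hQ : ∀ i, MeasurableSet (Q i))
    (hlam : ∀ i j, Q i ⊆ Q j ∨ Q j ⊆ Q i ∨ Disjoint (Q i) (Q j)) (t : ℝ≥0∞)
    (G : Finset ι) : (∀ i ∈ G, t * μ (Q i) ≤ ν (Q i)) →
      t * μ (⋃ i ∈ G, Q i) ≤ ν (⋃ i ∈ G, Q i) := by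
  classical
  induction G using Finset.strongInduction with
  | H G ih =>
  intro h
  rcases G.eq_empty_or_nonempty with rfl | ⟨i, hi⟩
  · simp
  by_cases hj : ∃ j ∈ G.erase i, Q i ⊆ Q j
  · obtain ⟨j, hj, hij⟩ := hj
    have hU : (⋃ i ∈ G, Q i) = ⋃ k ∈ G.erase i, Q k := by
      apply subset_antisymm
      · intro x hx
        simp only [mem_iUnion] at hx ⊢
        obtain ⟨k, hk, hx⟩ := hx
        by_cases hki : k = i
        · subst hki; exact ⟨j, hj, hij hx⟩
        · exact ⟨k, Finset.mem_erase.2 ⟨hki, hk⟩, hx⟩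
      · intro x hx
        simp only [mem_iUnion] at hx ⊢
        obtain ⟨k, hk, hx⟩ := hx
        exact ⟨k, Finset.mem_of_mem_erase hk, hx⟩
    rw [hU]
    exact ih _ (Finset.erase_ssubset hi) fun k hk => h k (Finset.mem_of_mem_erase hk)
  · push Not at hj
    set G' := (G.erase i).filter (fun j => Disjoint (Q i) (Q j)) with hG'
    have hU : (⋃ i ∈ G, Q i) = Q i ∪ ⋃ k ∈ G', Q k := by
      apply subset_antisymm
      · intro x hx
        simp only [mem_iUnion] at hx
        obtain ⟨k, hk, hx⟩ := hx
        by_cases hki : k = i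
        · subst hki; exact Or.inl hx
        · have hke : k ∈ G.erase i := Finset.mem_erase.2 ⟨hki, hk⟩
          rcases hlam i k with h1 | h1 | h1
          · exact absurd h1 (hj k hke)
          · exact Or.inl (h1 hx)
          · right
            simp only [mem_iUnion]
            exact ⟨k, Finset.mem_filter.2 ⟨hke, h1⟩, hx⟩
      · intro x hx
        simp only [mem_iUnion]
        rcases hx with hx | hx
        · exact ⟨i, hi, hx⟩
        · simp only [mem_iUnion] at hx
          obtain ⟨k, hk, hx⟩ := hx
          exact ⟨k, Finset.mem_of_mem_erase (Finset.mem_filter.1 hk).1, hx⟩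
    have hd : Disjoint (Q i) (⋃ k ∈ G', Q k) := by
      simp only [disjoint_iUnion_right]
      intro k hk
      exact (Finset.mem_filter.1 hk).2
    have hm : MeasurableSet (⋃ k ∈ G', Q k) := G'.measurableSet_biUnion fun k _ => hQ k
    rw [hU, measure_union hd hm, measure_union hd hm, mul_add]
    refine add_le_add (h i hi) (ih G' ?_ fun k hk => h k ?_)
    · exact lt_of_le_of_lt (Finset.filter_subset _ _) (Finset.erase_ssubset hi)
    · exact Finset.mem_of_mem_erase (Finset.mem_filter.1 hk).1

/-- Finite maximal function with prescribed heights. -/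
def finMax {X ι : Type*} (Q : ι → Set X) (a : ι → ℝ≥0∞) (F : Finset ι) (x : X) : ℝ≥0∞ :=
  F.sup fun i => (Q i).indicator (fun _ => a i) x

lemma finMax_meas {X ι : Type*} [MeasurableSpace X] (Q : ι → Set X)
    (hQ : ∀ i, MeasurableSet (Q i)) (a : ι → ℝ≥0∞) (F : Finset ι) :
    Measurable (finMax Q a F) := by
  unfold finMax
  simp only [Finset.sup_eq_iSup]
  exact Measurable.biSup (F : Set ι) F.countable_toSet
    (fun i _ => measurable_const.indicator (hQ i))

lemma finMax_lt_top {X ι : Type*} (Q : ι → Set X)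
    (a : ι → ℝ≥0∞) (ha : ∀ i, a i ≠ ∞) (F : Finset ι) (x : X) : finMax Q a F x < ∞ := by
  unfold finMax
  rw [Finset.sup_lt_iff (by simp)]
  intro i _
  by_cases h : x ∈ Q i <;> simp [h, (ha i).lt_top]

lemma lt_finMax {X ι : Type*} (Q : ι → Set X)
    (a : ι → ℝ≥0∞) (F : Finset ι) (t : ℝ≥0∞) :
    {x | t < finMax Q a F x} = ⋃ i ∈ F.filter (fun i => t < a i), Q i := by
  ext x
  simp only [finMax, Set.mem_ofPred_eq, Finset.lt_sup_iff, Set.mem_iUnion, Finset.mem_filter]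
  constructor
  · rintro ⟨i, hi, h⟩
    by_cases hx : x ∈ Q i
    · simp [hx] at h
      exact ⟨i, ⟨hi, h⟩, hx⟩
    · simp [hx] at h
  · rintro ⟨i, ⟨hi, h⟩, hx⟩
    exact ⟨i, hi, by simpa [hx] using h⟩

lemma lintegral_rpow_layer {X : Type*} [MeasurableSpace X] (μ : Measure X) (N : X → ℝ≥0∞)
    (hN : Measurable N) (hfin : ∀ x, N x < ∞) (q : ℝ) (hq : 0 < q) :
    ∫⁻ x, N x ^ q ∂μ = ENNReal.ofReal q *
      ∫⁻ t in Set.Ioi (0:ℝ), μ {x | ENNReal.ofReal t < N x} * ENNReal.ofReal (t ^ (q - 1)) := by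
  have := lintegral_rpow_eq_lintegral_meas_lt_mul μ (f := fun x => (N x).toReal)
    (Filter.Eventually.of_forall fun x => ENNReal.toReal_nonneg) hN.ennreal_toReal.aemeasurable hq
  have e : ∀ x, ENNReal.ofReal ((N x).toReal ^ q) = N x ^ q := by
    intro x
    rw [← ENNReal.ofReal_rpow_of_nonneg ENNReal.toReal_nonneg hq.le,
      ENNReal.ofReal_toReal (hfin x).ne]
  simp only [e] at this
  rw [this]
  congr 1
  refine setLIntegral_congr_fun measurableSet_Ioi ?_
  intro t ht
  have : {x | t < (N x).toReal} = {x | ENNReal.ofReal t < N x} := by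
    ext x
    simp only [Set.mem_ofPred_eq]
    rw [ENNReal.ofReal_lt_iff_lt_toReal (le_of_lt ht) (hfin x).ne]
  simp only [this]

lemma strong_fin {X ι : Type*} [MeasurableSpace X] (μ : Measure X) (Q : ι → Set X)
    (hQ : ∀ i, MeasurableSet (Q i))
    (hlam : ∀ i j, Q i ⊆ Q j ∨ Q j ⊆ Q i ∨ Disjoint (Q i) (Q j))
    (hμ0 : ∀ i, μ (Q i) ≠ 0) (hμ : ∀ i, μ (Q i) ≠ ∞) (g : X → ℝ≥0∞) (hg : Measurable g)
    (q q' : ℝ) (hqq : q.HolderConjugate q') (F : Finset ι) :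
    ∫⁻ x, finMax Q (fun i => (∫⁻ y in Q i, g y ∂μ) / μ (Q i)) F x ^ q ∂μ ≤
      ENNReal.ofReal q' ^ q * ∫⁻ x, g x ^ q ∂μ := by
  classical
  have hq0 := hqq.pos
  have hq1 := hqq.lt
  have hq'0 := hqq.symm.pos
  by_cases hfin : ∫⁻ x, g x ^ q ∂μ = ∞
  · rw [hfin, ENNReal.mul_top]
    · exact le_top
    · simp [hq0, hq'0]
  set a : ι → ℝ≥0∞ := fun i => (∫⁻ y in Q i, g y ∂μ) / μ (Q i) with ha_def
  have hgi : ∀ i, ∫⁻ y in Q i, g y ∂μ ≠ ∞ := by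
    intro i
    have h1 := ENNReal.lintegral_mul_le_Lp_mul_Lq (μ.restrict (Q i)) hqq hg.aemeasurable
      (aemeasurable_const (b := (1 : ℝ≥0∞)))
    simp only [Pi.mul_apply, mul_one, ENNReal.one_rpow, lintegral_one, Measure.restrict_apply,
      MeasurableSet.univ, Set.univ_inter] at h1
    refine ne_top_of_le_ne_top ?_ h1
    refine ENNReal.mul_ne_top ?_ ?_
    · exact ENNReal.rpow_ne_top_of_nonneg (by positivity)
        (ne_top_of_le_ne_top hfin (setLIntegral_le_lintegral _ _))
    · exact ENNReal.rpow_ne_top_of_nonneg (by positivity) (hμ i)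
  have ha : ∀ i, a i ≠ ∞ := fun i => ENNReal.div_ne_top (hgi i) (hμ0 i)
  have haμ : ∀ i, a i * μ (Q i) = ∫⁻ y in Q i, g y ∂μ := fun i =>
    ENNReal.div_mul_cancel (hμ0 i) (hμ i)
  set N := finMax Q a F with hN_def
  have hNm : Measurable N := finMax_meas Q hQ a F
  have hNf : ∀ x, N x < ∞ := finMax_lt_top Q a ha F
  set ν := μ.withDensity g with hν
  have hweak : ∀ t : ℝ≥0∞, t * μ {x | t < N x} ≤ ν {x | t < N x} := by
    intro t
    rw [hN_def, lt_finMax]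
    apply weak_union μ ν Q hQ hlam
    intro i hi
    rw [hν, withDensity_apply _ (hQ i), ← haμ i]
    gcongr
    exact (Finset.mem_filter.1 hi).2.le
  have key : ∫⁻ x, N x ^ q ∂μ ≤ ENNReal.ofReal q' * ∫⁻ x, g x * N x ^ (q - 1) ∂μ := by
    have h1 := lintegral_rpow_layer μ N hNm hNf q hq0
    have h2 := lintegral_rpow_layer ν N hNm hNf (q - 1) (by linarith)
    have h3 : ∫⁻ x, N x ^ (q - 1) ∂ν = ∫⁻ x, g x * N x ^ (q - 1) ∂μ := by
      rw [hν, lintegral_withDensity_eq_lintegral_mul _ hg (hNm.pow_const _)]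
      rfl
    rw [← h3, h2, h1, ← mul_assoc, ← ENNReal.ofReal_mul hq'0.le,
      show q' * (q - 1) = q from by rw [mul_comm]; exact hqq.sub_one_mul_conj]
    refine mul_le_mul' le_rfl (setLIntegral_mono' measurableSet_Ioi ?_)
    intro t ht
    have ht0 : (0:ℝ) < t := ht
    have : ENNReal.ofReal (t ^ (q - 1)) = ENNReal.ofReal t * ENNReal.ofReal (t ^ (q - 1 - 1)) := by
      rw [← ENNReal.ofReal_mul ht0.le]
      congr 1
      rw [Real.rpow_sub_one ht0.ne' (q-1)]
      field_simp
    rw [this, ← mul_assoc, mul_comm (μ _)]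
    gcongr
    exact hweak _
  have hIfin : ∫⁻ x, N x ^ q ∂μ ≠ ∞ := by
    have hb : ∀ x, N x ^ q ≤ ∑ i ∈ F, (Q i).indicator (fun _ => a i ^ q) x := by
      intro x
      have hle : N x ^ q ≤ F.sup fun i => (Q i).indicator (fun _ => a i ^ q) x := by
        rw [hN_def]
        unfold finMax
        rcases F.eq_empty_or_nonempty with rfl | hne
        · simp [hq0]
        · obtain ⟨i, hi, e⟩ := Finset.exists_mem_eq_sup F hne
            (fun i => (Q i).indicator (fun _ => a i) x)
          rw [e]
          refine le_trans ?_ (Finset.le_sup hi)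
          by_cases hx : x ∈ Q i <;> simp [hx, hq0]
      refine hle.trans ?_
      refine Finset.sup_le fun i hi => ?_
      exact Finset.single_le_sum (f := fun i => (Q i).indicator (fun _ => a i ^ q) x)
        (fun _ _ => zero_le) hi
    refine ne_top_of_le_ne_top ?_ (lintegral_mono hb)
    rw [lintegral_finsetSum _ fun i _ => measurable_const.indicator (hQ i)]
    refine ENNReal.sum_ne_top.2 fun i _ => ?_
    rw [lintegral_indicator_const (hQ i)]
    exact ENNReal.mul_ne_top (ENNReal.rpow_ne_top_of_nonneg hq0.le (ha i)) (hμ i)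
  have hold := ENNReal.lintegral_mul_le_Lp_mul_Lq μ hqq hg.aemeasurable
    (hNm.pow_const (q - 1)).aemeasurable
  have e1 : ∀ x, (N x ^ (q - 1)) ^ q' = N x ^ q := by
    intro x
    rw [← ENNReal.rpow_mul, hqq.sub_one_mul_conj]
  simp only [Pi.mul_apply, e1] at hold
  set I := ∫⁻ x, N x ^ q ∂μ with hI
  set J := ∫⁻ x, g x ^ q ∂μ with hJ
  have h4 : I ≤ ENNReal.ofReal q' * (J ^ (1/q) * I ^ (1/q')) := key.trans (by gcongr)
  by_cases hI0 : I = 0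
  · rw [hI0]; exact zero_le
  have h5 : I ^ (1/q) ≤ ENNReal.ofReal q' * J ^ (1/q) := by
    have e2 : I = I ^ (1/q) * I ^ (1/q') := by
      rw [← ENNReal.rpow_add _ _ hI0 hIfin]
      have : 1/q + 1/q' = 1 := by simpa using hqq.inv_add_inv_eq_one
      rw [this, ENNReal.rpow_one]
    rw [← mul_assoc] at h4
    nth_rewrite 1 [e2] at h4
    refine (ENNReal.mul_le_mul_iff_left ?_ ?_).1 h4
    · simp [hI0, hIfin]
    · exact ENNReal.rpow_ne_top_of_nonneg (by positivity) hIfin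
  have h6 := ENNReal.rpow_le_rpow h5 hq0.le
  rw [ENNReal.mul_rpow_of_nonneg _ _ hq0.le, ← ENNReal.rpow_mul, ← ENNReal.rpow_mul,
    one_div_mul_cancel hq0.ne', ENNReal.rpow_one, ENNReal.rpow_one] at h6
  exact h6

lemma setLIntegral_ne_zero_aux {X : Type*} [MeasurableSpace X] (μ : Measure X) (Q : Set X)
    (hQ0 : μ Q ≠ 0) (w : X → ℝ≥0∞) (hw : Measurable w) (hpos : ∀ᵐ x ∂μ, 0 < w x) :
    ∫⁻ x in Q, w x ∂μ ≠ 0 := by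
  intro h
  rw [lintegral_eq_zero_iff hw] at h
  have h2 : ∀ᵐ x ∂(μ.restrict Q), False := by
    filter_upwards [h, ae_restrict_of_ae hpos] with x h1 h2
    exact h2.ne' h1
  rw [Filter.eventually_false_iff_eq_bot, ae_eq_bot, Measure.restrict_eq_zero] at h2
  exact hQ0 h2

lemma lerner_fin {X ι : Type*} [MeasurableSpace X] (μ : Measure X) (Q : ι → Set X)
    (hQ : ∀ i, MeasurableSet (Q i))
    (hlam : ∀ i j, Q i ⊆ Q j ∨ Q j ⊆ Q i ∨ Disjoint (Q i) (Q j))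
    (hμ0 : ∀ i, μ (Q i) ≠ 0) (hμ : ∀ i, μ (Q i) ≠ ∞)
    (p p' : ℝ) (hpp : p.HolderConjugate p')
    (w : X → ℝ≥0∞) (hw : Measurable w) (hw0 : ∀ᵐ x ∂μ, 0 < w x ∧ w x < ∞)
    (A : ℝ≥0∞) (hA : A ≠ ∞)
    (hQA : ∀ i, (∫⁻ x in Q i, w x ∂μ) / μ (Q i) *
      ((∫⁻ x in Q i, w x ^ (-(1 / (p - 1))) ∂μ) / μ (Q i)) ^ (p - 1) ≤ A)
    (f : X → ℝ≥0∞) (hf : Measurable f) (F : Finset ι) :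
    ∫⁻ x, finMax Q (fun i => (∫⁻ y in Q i, f y ∂μ) / μ (Q i)) F x ^ p * w x ∂μ ≤
      A ^ p' * (ENNReal.ofReal p ^ p' * (ENNReal.ofReal p' ^ p * ∫⁻ x, f x ^ p * w x ∂μ)) := by
  have hp0 := hpp.pos
  have hp1 : 0 < p - 1 := by linarith [hpp.lt]
  have hp'0 := hpp.symm.pos
  have hpm : (p - 1) * p' = p := hpp.sub_one_mul_conj
  set s : ℝ := 1 / (p - 1) with hs
  have hs0 : 0 < s := by positivity
  have hsp : s * (p - 1) = 1 := by rw [hs]; field_simp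
  have hsp' : s = p' - 1 := by
    rw [hs]; field_simp; linarith
  set σ : X → ℝ≥0∞ := fun x => w x ^ (-s) with hσ
  have hσm : Measurable σ := hw.pow_const _
  have hσ0 : ∀ᵐ x ∂μ, 0 < σ x := by
    filter_upwards [hw0] with x hx
    exact pos_iff_ne_zero.2 (by simp [hσ, ENNReal.rpow_eq_zero_iff, hx.1.ne', hx.2.ne])
  have hW0 : ∀ i, ∫⁻ x in Q i, w x ∂μ ≠ 0 := fun i =>
    setLIntegral_ne_zero_aux μ _ (hμ0 i) w hw (hw0.mono fun x h => h.1)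
  have hS0 : ∀ i, ∫⁻ x in Q i, σ x ∂μ ≠ 0 := fun i =>
    setLIntegral_ne_zero_aux μ _ (hμ0 i) σ hσm hσ0
  have hWt : ∀ i, ∫⁻ x in Q i, w x ∂μ ≠ ∞ := by
    intro i h
    have := hQA i
    rw [h, ENNReal.top_div_of_ne_top (hμ i), ENNReal.top_mul] at this
    · exact hA (top_le_iff.1 this)
    · have : 0 < ((∫⁻ x in Q i, σ x ∂μ) / μ (Q i)) ^ (p - 1) := by
        have h0 := ENNReal.div_pos (hS0 i) (hμ i)
        refine pos_iff_ne_zero.2 fun hz => ?_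
        rw [ENNReal.rpow_eq_zero_iff_of_pos hp1] at hz
        exact h0.ne' hz
      exact this.ne'
  have hSt : ∀ i, ∫⁻ x in Q i, σ x ∂μ ≠ ∞ := by
    intro i h
    have := hQA i
    rw [show (∫⁻ x in Q i, w x ^ (-s) ∂μ) = ∞ from h, ENNReal.top_div_of_ne_top (hμ i),
      ENNReal.top_rpow_of_pos hp1, ENNReal.mul_top] at this
    · exact hA (top_le_iff.1 this)
    · exact (ENNReal.div_pos (hW0 i) (hμ i)).ne'
  have hμw : ∀ i, μ.withDensity w (Q i) = ∫⁻ x in Q i, w x ∂μ := fun i =>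
    withDensity_apply _ (hQ i)
  have hμσ : ∀ i, μ.withDensity σ (Q i) = ∫⁻ x in Q i, σ x ∂μ := fun i =>
    withDensity_apply _ (hQ i)
  set h : X → ℝ≥0∞ := fun x => f x * w x ^ s with hh
  have hhm : Measurable h := hf.mul (hw.pow_const _)
  have st1 := strong_fin (μ.withDensity σ) Q hQ hlam (fun i => by rw [hμσ]; exact hS0 i)
    (fun i => by rw [hμσ]; exact hSt i) h hhm p p' hpp F
  set b : ι → ℝ≥0∞ := fun i => (∫⁻ y in Q i, h y ∂μ.withDensity σ) / μ.withDensity σ (Q i) with hb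
  set Nσ := finMax Q b F with hNσ
  have hNσm : Measurable Nσ := finMax_meas Q hQ b F
  set g : X → ℝ≥0∞ := fun x => Nσ x ^ (p - 1) * (w x)⁻¹ with hg
  have hgm : Measurable g := (hNσm.pow_const _).mul hw.inv
  have st2 := strong_fin (μ.withDensity w) Q hQ hlam (fun i => by rw [hμw]; exact hW0 i)
    (fun i => by rw [hμw]; exact hWt i) g hgm p' p hpp.symm F
  set d : ι → ℝ≥0∞ := fun i => (∫⁻ y in Q i, g y ∂μ.withDensity w) / μ.withDensity w (Q i) with hd
  set Nw := finMax Q d F with hNw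
  have hNwm : Measurable Nw := finMax_meas Q hQ d F
  -- pointwise
  have hpt : ∀ i ∈ F, ((∫⁻ y in Q i, f y ∂μ) / μ (Q i)) ^ (p - 1) ≤ A * d i := by
    intro i hi
    have e1 : ∫⁻ y in Q i, f y ∂μ = b i * ∫⁻ x in Q i, σ x ∂μ := by
      rw [hb]
      simp only
      rw [hμσ, ENNReal.div_mul_cancel (hS0 i) (hSt i),
        setLIntegral_withDensity_eq_setLIntegral_mul μ hσm hhm (hQ i)]
      refine lintegral_congr_ae (ae_restrict_of_ae ?_)
      filter_upwards [hw0] with x hx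
      simp only [Pi.mul_apply, hσ, hh]
      rw [mul_left_comm, ← ENNReal.rpow_add _ _ hx.1.ne' hx.2.ne]
      simp
    have e2 : b i ^ (p - 1) * μ (Q i) ≤ ∫⁻ y in Q i, g y ∂μ.withDensity w := by
      rw [setLIntegral_withDensity_eq_setLIntegral_mul μ hw hgm (hQ i), ← setLIntegral_const]
      refine lintegral_mono_ae ?_
      filter_upwards [ae_restrict_of_ae hw0, ae_restrict_mem (hQ i)] with x hx hxQ
      simp only [Pi.mul_apply, hg]
      rw [mul_left_comm, ENNReal.mul_inv_cancel hx.1.ne' hx.2.ne, mul_one]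
      refine ENNReal.rpow_le_rpow ?_ hp1.le
      have := Finset.le_sup (f := fun i => (Q i).indicator (fun _ => b i) x) hi
      simpa [hxQ, hNσ, finMax] using this
    have e3 : ∫⁻ y in Q i, g y ∂μ.withDensity w = d i * ∫⁻ x in Q i, w x ∂μ := by
      rw [hd]
      simp only
      rw [hμw, ENNReal.div_mul_cancel (hW0 i) (hWt i)]
    have e4 : b i ^ (p - 1) ≤ d i * ((∫⁻ x in Q i, w x ∂μ) / μ (Q i)) := by
      rw [← mul_div_assoc, ENNReal.le_div_iff_mul_le (Or.inl (hμ0 i)) (Or.inl (hμ i)), ← e3]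
      exact e2
    rw [e1, mul_div_assoc, ENNReal.mul_rpow_of_nonneg _ _ hp1.le]
    calc _ ≤ d i * ((∫⁻ x in Q i, w x ∂μ) / μ (Q i)) *
          ((∫⁻ x in Q i, σ x ∂μ) / μ (Q i)) ^ (p - 1) := by gcongr
      _ = ((∫⁻ x in Q i, w x ∂μ) / μ (Q i) *
          ((∫⁻ x in Q i, σ x ∂μ) / μ (Q i)) ^ (p - 1)) * d i := by ring
      _ ≤ A * d i := by gcongr; exact hQA i
  have hpt2 : ∀ x, finMax Q (fun i => (∫⁻ y in Q i, f y ∂μ) / μ (Q i)) F x ^ p ≤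
      A ^ p' * Nw x ^ p' := by
    intro x
    have : finMax Q (fun i => (∫⁻ y in Q i, f y ∂μ) / μ (Q i)) F x ^ (p - 1) ≤ A * Nw x := by
      unfold finMax
      rcases F.eq_empty_or_nonempty with rfl | hne
      · simp [hp1]
      · obtain ⟨i, hi, e⟩ := Finset.exists_mem_eq_sup F hne
          (fun i => (Q i).indicator (fun _ => (∫⁻ y in Q i, f y ∂μ) / μ (Q i)) x)
        rw [e]
        by_cases hx : x ∈ Q i
        · simp only [hx, Set.indicator_of_mem]
          refine (hpt i hi).trans ?_
          gcongr
          have := Finset.le_sup (f := fun i => (Q i).indicator (fun _ => d i) x) hi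
          simpa [hx, hNw, finMax] using this
        · simp [hx, hp1]
    rw [← ENNReal.mul_rpow_of_nonneg _ _ hp'0.le]
    have h2 := ENNReal.rpow_le_rpow this hp'0.le
    rwa [← ENNReal.rpow_mul, hpm] at h2
  have i1 : ∫⁻ x, g x ^ p' ∂μ.withDensity w = ∫⁻ x, Nσ x ^ p ∂μ.withDensity σ := by
    rw [lintegral_withDensity_eq_lintegral_mul _ hw (hgm.pow_const _),
      lintegral_withDensity_eq_lintegral_mul _ hσm (hNσm.pow_const _)]
    refine lintegral_congr_ae ?_
    filter_upwards [hw0] with x hx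
    simp only [Pi.mul_apply, hg, hσ]
    rw [ENNReal.mul_rpow_of_nonneg _ _ hp'0.le, ← ENNReal.rpow_mul, hpm, mul_left_comm, mul_comm]
    congr 1
    rw [← ENNReal.rpow_neg_one, ← ENNReal.rpow_mul]
    nth_rewrite 1 [← ENNReal.rpow_one (w x)]
    rw [← ENNReal.rpow_add _ _ hx.1.ne' hx.2.ne]
    congr 1
    rw [hsp']; ring
  have i2 : ∫⁻ x, h x ^ p ∂μ.withDensity σ = ∫⁻ x, f x ^ p * w x ∂μ := by
    rw [lintegral_withDensity_eq_lintegral_mul _ hσm (hhm.pow_const _)]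
    refine lintegral_congr_ae ?_
    filter_upwards [hw0] with x hx
    simp only [Pi.mul_apply, hh, hσ]
    rw [ENNReal.mul_rpow_of_nonneg _ _ hp0.le, ← ENNReal.rpow_mul, mul_left_comm]
    congr 1
    rw [← ENNReal.rpow_add _ _ hx.1.ne' hx.2.ne]
    rw [show -s + s * p = 1 by linarith, ENNReal.rpow_one]
  calc _ ≤ ∫⁻ x, A ^ p' * (w x * Nw x ^ p') ∂μ := by
        refine lintegral_mono fun x => ?_
        calc _ ≤ (A ^ p' * Nw x ^ p') * w x := by gcongr; exact hpt2 x
          _ = _ := by ring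
    _ = A ^ p' * ∫⁻ x, Nw x ^ p' ∂μ.withDensity w := by
        have hm : Measurable fun x => w x * Nw x ^ p' := hw.mul (hNwm.pow_const _)
        rw [lintegral_const_mul _ hm,
          lintegral_withDensity_eq_lintegral_mul _ hw (hNwm.pow_const _)]
        rfl
    _ ≤ _ := by
        gcongr
        refine st2.trans ?_
        gcongr
        rw [i1, ← i2]
        exact st1

/-- shift of the grid `a ∈ {0,1,2}` at level `k` (in units of the side length). -/
def gshift (a : Fin 3) (k : ℤ) : ℝ := (-1 : ℝ) ^ k * (a : ℕ) / 3

/-- index of the interval of the grid at level `k` containing `x`. -/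
def gidx (a : Fin 3) (k : ℤ) (x : ℝ) : ℤ := ⌊x / (2:ℝ) ^ k - gshift a k⌋

lemma negone_zpow (k : ℤ) : (-1 : ℝ) ^ k = 1 ∨ (-1 : ℝ) ^ k = -1 := by
  rcases Int.even_or_odd k with h | h
  · left; exact h.neg_one_zpow
  · right; exact h.neg_one_zpow

lemma gidx_succ (a : Fin 3) (k : ℤ) (x y : ℝ) (h : gidx a k x = gidx a k y) :
    gidx a (k + 1) x = gidx a (k + 1) y := by
  obtain ⟨N, hN⟩ : ∃ N : ℤ, gshift a k - 2 * gshift a (k + 1) = N := by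
    unfold gshift
    rw [zpow_add_one₀ (by norm_num)]
    rcases negone_zpow k with h | h
    · rw [h]; refine ⟨(a : ℕ), ?_⟩; push_cast; ring
    · rw [h]; refine ⟨-(a : ℕ), ?_⟩; push_cast; ring
  have key : ∀ z : ℝ, gidx a (k + 1) z = (gidx a k z + N) / 2 := by
    intro z
    unfold gidx
    have e : z / (2:ℝ) ^ (k + 1) - gshift a (k + 1) =
        (z / (2:ℝ) ^ k - gshift a k + N) / 2 := by
      rw [← hN, zpow_add_one₀ (by norm_num)]
      field_simp
      ring
    rw [e]
    set y := z / (2:ℝ) ^ k - gshift a k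
    rw [Int.floor_eq_iff]
    have h1 := Int.floor_le y
    have h2 := Int.lt_floor_add_one y
    have h3 : 2 * ((⌊y⌋ + N) / 2) ≤ ⌊y⌋ + N := by omega
    have h4 : ⌊y⌋ + N + 1 ≤ 2 * ((⌊y⌋ + N) / 2) + 2 := by omega
    have h3' : (2:ℝ) * (((⌊y⌋ + N) / 2 : ℤ) : ℝ) ≤ ⌊y⌋ + N := by exact_mod_cast h3
    have h4' : (⌊y⌋ + N + 1 : ℝ) ≤ 2 * (((⌊y⌋ + N) / 2 : ℤ) : ℝ) + 2 := by exact_mod_cast h4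
    constructor <;> linarith
  rw [key, key, h]

lemma gidx_le (a : Fin 3) (j k : ℤ) (hjk : j ≤ k) (x y : ℝ) (h : gidx a j x = gidx a j y) :
    gidx a k x = gidx a k y := by
  induction k, hjk using Int.leInduction with
  | base => exact h
  | succ k _ ih => exact gidx_succ a k x y ih

/-- the dyadic cube of level `k` and index `m` in the grid `α`. -/
def dcube {n : ℕ} (α : Fin n → Fin 3) (i : ℤ × (Fin n → ℤ)) : Set (Fin n → ℝ) :=
  {x | ∀ l, gidx (α l) i.1 (x l) = i.2 l}

lemma dcube_laminar {n : ℕ} (α : Fin n → Fin 3) (i j : ℤ × (Fin n → ℤ)) :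
    dcube α i ⊆ dcube α j ∨ dcube α j ⊆ dcube α i ∨ Disjoint (dcube α i) (dcube α j) := by
  have key : ∀ i j : ℤ × (Fin n → ℤ), i.1 ≤ j.1 → ¬ Disjoint (dcube α i) (dcube α j) →
      dcube α i ⊆ dcube α j := by
    intro i j hij hd
    obtain ⟨z, hz1, hz2⟩ := Set.not_disjoint_iff.1 hd
    intro x hx l
    rw [← hz2 l]
    exact gidx_le _ _ _ hij _ _ ((hx l).trans (hz1 l).symm)
  by_cases hd : Disjoint (dcube α i) (dcube α j)
  · exact Or.inr (Or.inr hd)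
  · rcases le_total i.1 j.1 with h | h
    · exact Or.inl (key i j h hd)
    · exact Or.inr (Or.inl (key j i h fun h' => hd h'.symm))

/-- lower corner -/
def dlow {n : ℕ} (α : Fin n → Fin 3) (i : ℤ × (Fin n → ℤ)) (l : Fin n) : ℝ :=
  (2:ℝ) ^ i.1 * (i.2 l + gshift (α l) i.1)

lemma dcube_eq {n : ℕ} (α : Fin n → Fin 3) (i : ℤ × (Fin n → ℤ)) :
    dcube α i = Set.univ.pi fun l => Set.Ico (dlow α i l) (dlow α i l + (2:ℝ) ^ i.1) := by
  ext x
  simp only [dcube, Set.mem_pi, Set.mem_univ, true_imp_iff, Set.mem_Ico, Set.mem_ofPred_eq]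
  refine forall_congr' fun l => ?_
  have h2 : (0:ℝ) < (2:ℝ) ^ i.1 := by positivity
  unfold gidx dlow
  rw [Int.floor_eq_iff, le_sub_iff_add_le, le_div_iff₀ h2, sub_lt_iff_lt_add, div_lt_iff₀ h2]
  constructor
  · rintro ⟨h, h'⟩; constructor <;> linarith
  · rintro ⟨h, h'⟩; constructor <;> linarith

lemma dcube_meas {n : ℕ} (α : Fin n → Fin 3) (i : ℤ × (Fin n → ℤ)) :
    MeasurableSet (dcube α i) := by
  rw [dcube_eq]
  exact MeasurableSet.univ_pi fun l => measurableSet_Ico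

lemma dcube_vol {n : ℕ} (α : Fin n → Fin 3) (i : ℤ × (Fin n → ℤ)) :
    volume (dcube α i) = ENNReal.ofReal ((2:ℝ) ^ i.1) ^ n := by
  rw [dcube_eq, Real.volume_pi_Ico]
  simp

lemma cube_eq {n : ℕ} (c : Fin n → ℝ) (r : ℝ) :
    {x : Fin n → ℝ | ∀ i, |x i - c i| ≤ r} =
      Set.univ.pi fun l => Set.Icc (c l - r) (c l + r) := by
  ext x
  simp only [Set.mem_pi, Set.mem_univ, true_imp_iff, Set.mem_Icc, Set.mem_ofPred_eq, abs_le]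
  refine forall_congr' fun l => ?_
  constructor
  · rintro ⟨h, h'⟩; constructor <;> linarith
  · rintro ⟨h, h'⟩; constructor <;> linarith

lemma cube_vol {n : ℕ} (c : Fin n → ℝ) (r : ℝ) :
    volume {x : Fin n → ℝ | ∀ i, |x i - c i| ≤ r} = ENNReal.ofReal (2 * r) ^ n := by
  rw [cube_eq, volume_pi_pi]
  have : ∀ l, volume (Set.Icc (c l - r) (c l + r)) = ENNReal.ofReal (2 * r) := by
    intro l
    rw [Real.volume_Icc]
    congr 1; ring
  simp [this]

lemma dcube_sub {n : ℕ} (α : Fin n → Fin 3) (i : ℤ × (Fin n → ℤ)) :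
    ∃ P, IsCube P ∧ dcube α i ⊆ P ∧ volume P = volume (dcube α i) := by
  have h2 : (0:ℝ) < (2:ℝ) ^ i.1 := by positivity
  refine ⟨_, ⟨fun l => dlow α i l + (2:ℝ) ^ i.1 / 2, (2:ℝ) ^ i.1 / 2, by positivity, rfl⟩, ?_, ?_⟩
  · rw [cube_eq, dcube_eq]
    refine Set.pi_mono fun l _ => ?_
    intro y hy
    rw [Set.mem_Ico] at hy
    rw [Set.mem_Icc]
    constructor <;> linarith [hy.1, hy.2]
  · rw [cube_vol, dcube_vol]
    congr 2; ring

lemma third_trick (s u v : ℝ) (hs : s = 1 ∨ s = -1) (huv : u ≤ v) (h : v < u + 2 / 3) :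
    ∃ a : Fin 3, ⌊u - s * (a : ℕ) / 3⌋ = ⌊v - s * (a : ℕ) / 3⌋ := by
  obtain ⟨e, he, hes⟩ : ∃ e : ℤ, (e = 1 ∨ e = -1) ∧ s = e := by
    rcases hs with h | h
    · exact ⟨1, Or.inl rfl, by simp [h]⟩
    · exact ⟨-1, Or.inr rfl, by simp [h]⟩
  by_contra! hc
  have key : ∀ a : Fin 3, ∃ m : ℤ, 3 * u < ((3 * m + e * (a : ℕ) : ℤ) : ℝ) ∧
      ((3 * m + e * (a : ℕ) : ℤ) : ℝ) ≤ 3 * v := by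
    intro a
    have hle : ⌊u - s * (a : ℕ) / 3⌋ ≤ ⌊v - s * (a : ℕ) / 3⌋ := Int.floor_le_floor (by linarith)
    have hlt := lt_of_le_of_ne hle (hc a)
    refine ⟨⌊v - s * (a : ℕ) / 3⌋, ?_, ?_⟩
    · have := Int.floor_lt.1 hlt
      push_cast
      rw [← hes]; linarith
    · have := Int.floor_le (v - s * (a : ℕ) / 3)
      push_cast
      rw [← hes]; linarith
  have close : ∀ z z' : ℤ, 3 * u < (z : ℝ) → (z' : ℝ) ≤ 3 * v → z' < z + 2 := by
    intro z z' h1 h2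
    have : (z' : ℝ) < ((z + 2 : ℤ) : ℝ) := by push_cast; linarith
    exact_mod_cast this
  obtain ⟨m0, h0, h0'⟩ := key 0
  obtain ⟨m1, h1, h1'⟩ := key 1
  obtain ⟨m2, h2, h2'⟩ := key 2
  have a1 := close _ _ h0 h1'
  have a2 := close _ _ h0 h2'
  have a3 := close _ _ h1 h0'
  have a4 := close _ _ h1 h2'
  have a5 := close _ _ h2 h0'
  have a6 := close _ _ h2 h1'
  simp only [Fin.val_zero, Fin.val_one, Fin.val_two, Nat.cast_zero, Nat.cast_one,
    Nat.cast_ofNat] at a1 a2 a3 a4 a5 a6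
  rcases he with rfl | rfl <;> omega

lemma cube_cover {n : ℕ} (Q : Set (Fin n → ℝ)) (hQ : IsCube Q) :
    ∃ α i, Q ⊆ dcube α i ∧ volume (dcube α i) ≤ 3 ^ n * volume Q ∧
      volume Q ≠ 0 ∧ volume Q ≠ ∞ := by
  obtain ⟨c, r, hr, rfl⟩ := hQ
  obtain ⟨m, hm1, hm2⟩ := _root_.exists_mem_Ico_zpow (x := 3 * r) (y := (2:ℝ))
    (by positivity) (by norm_num)
  set k := m + 1 with hk
  have h2 : (0:ℝ) < (2:ℝ) ^ k := by positivity
  have hk2 : (2:ℝ) ^ k ≤ 3 * (2 * r) := by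
    rw [hk, zpow_add_one₀ (by norm_num)]; linarith
  have hex : ∀ l, ∃ a : Fin 3, gidx a k (c l - r) = gidx a k (c l + r) := by
    intro l
    unfold gidx gshift
    refine third_trick _ _ _ (negone_zpow k) ?_ ?_
    · gcongr; linarith
    · rw [div_lt_iff₀ h2, add_mul, div_mul_cancel₀ _ h2.ne']; linarith
  choose α hα using hex
  refine ⟨α, (k, fun l => gidx (α l) k (c l - r)), ?_, ?_, ?_, ?_⟩
  · intro x hx l
    have hx := abs_le.1 (hx l)
    apply le_antisymm
    · simp only
      rw [hα l]
      unfold gidx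
      refine Int.floor_le_floor ?_
      gcongr; linarith
    · unfold gidx
      refine Int.floor_le_floor ?_
      gcongr; linarith
  · rw [dcube_vol, cube_vol, ← mul_pow]
    gcongr
    rw [show (3:ℝ≥0∞) = ENNReal.ofReal 3 by simp, ← ENNReal.ofReal_mul (by norm_num)]
    exact ENNReal.ofReal_le_ofReal hk2
  · rw [cube_vol]
    exact pow_ne_zero _ (by simpa using hr)
  · rw [cube_vol]
    exact ENNReal.pow_ne_top ENNReal.ofReal_ne_top

lemma real_const (p : ℝ) (hp : 1 < p) :
    p ^ (1 / (p - 1)) * (p / (p - 1)) ≤ 2 * (3:ℝ) ^ (1 / (p - 1) + 5 / p) := by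
  have hp0 : 0 < p := by linarith
  have hp1 : 0 < p - 1 := by linarith
  have h3 : 1 ≤ Real.log 3 := by
    rw [Real.le_log_iff_exp_le (by norm_num)]
    linarith [Real.exp_one_lt_d9]
  have a1 : p / (p - 1) ≤ (3:ℝ) ^ (1 / (p - 1)) := by
    rw [Real.rpow_def_of_pos (by norm_num)]
    have := Real.add_one_le_exp (1 / (p - 1))
    have e : p / (p - 1) = 1 / (p - 1) + 1 := by field_simp; ring
    rw [e]
    refine this.trans (Real.exp_le_exp.2 ?_)
    have : 0 < 1 / (p - 1) := by positivity
    nlinarith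
  have a2 : p ^ (1 / (p - 1)) ≤ 2 * (3:ℝ) ^ (5 / p) := by
    rcases le_total 2 p with h | h
    · have b1 : p ^ (1 / (p - 1)) ≤ 2 := by
        have : p ≤ 2 ^ (p - 1) := by
          have := one_add_mul_self_le_rpow_one_add (s := 1) (by norm_num) (p := p - 1) (by linarith)
          norm_num at this
          linarith
        calc p ^ (1 / (p - 1)) ≤ ((2:ℝ) ^ (p - 1)) ^ (1 / (p - 1)) := by gcongr
          _ = 2 := by
            rw [← Real.rpow_mul (by norm_num), mul_one_div_cancel hp1.ne', Real.rpow_one]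
      have b2 : 1 ≤ (3:ℝ) ^ (5 / p) := Real.one_le_rpow (by norm_num) (by positivity)
      linarith
    · have b1 : p ^ (1 / (p - 1)) ≤ 3 := by
        have : p ≤ 3 ^ (p - 1) := by
          rw [Real.rpow_def_of_pos (by norm_num)]
          have := Real.add_one_le_exp (Real.log 3 * (p - 1))
          nlinarith
        calc p ^ (1 / (p - 1)) ≤ ((3:ℝ) ^ (p - 1)) ^ (1 / (p - 1)) := by gcongr
          _ = 3 := by
            rw [← Real.rpow_mul (by norm_num), mul_one_div_cancel hp1.ne', Real.rpow_one]
      have b2 : (3:ℝ) ^ (1:ℝ) ≤ (3:ℝ) ^ (5 / p) := by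
        refine Real.rpow_le_rpow_of_exponent_le (by norm_num) ?_
        rw [le_div_iff₀ hp0]; linarith
      rw [Real.rpow_one] at b2
      linarith
  rw [Real.rpow_add (by norm_num)]
  calc _ ≤ (2 * (3:ℝ) ^ (5 / p)) * (3:ℝ) ^ (1 / (p - 1)) := by gcongr
    _ = _ := by ring

lemma enn_const (p : ℝ) (hp : 1 < p) (n : ℕ) (hn : n ≠ 0) :
    ENNReal.ofReal p ^ (1 / (p - 1)) * ENNReal.ofReal (p / (p - 1)) ≤
      2 ^ (n : ℝ) * 3 ^ ((n : ℝ) * (1 / (p - 1) + 5 / p)) := by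
  have hp0 : 0 < p := by linarith
  have hp1 : 0 < p - 1 := by linarith
  have h := ENNReal.ofReal_le_ofReal (real_const p hp)
  rw [ENNReal.ofReal_mul (by positivity), ENNReal.ofReal_mul (by positivity),
    ← ENNReal.ofReal_rpow_of_pos hp0, ← ENNReal.ofReal_rpow_of_pos (by norm_num)] at h
  simp only [ENNReal.ofReal_ofNat] at h
  refine h.trans ?_
  have hn1 : (1:ℝ) ≤ n := by exact_mod_cast Nat.one_le_iff_ne_zero.2 hn
  have hc : 0 < 1 / (p - 1) + 5 / p := by positivity
  gcongr
  · calc (2:ℝ≥0∞) = 2 ^ (1:ℝ) := by simp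
      _ ≤ _ := ENNReal.rpow_le_rpow_of_exponent_le (by norm_num) hn1
  · norm_num
  · nlinarith

lemma dyadic_bound {n : ℕ} (p p' : ℝ) (hpp : p.HolderConjugate p')
    (w : (Fin n → ℝ) → ℝ≥0∞) (hw : IsWeight w) (hA : apSup p w ≠ ∞)
    (g : (Fin n → ℝ) → ℝ≥0∞) (hg : Measurable g) (α : Fin n → Fin 3) :
    ∫⁻ x, (⨆ i, (dcube α i).indicator (fun _ => avgE (dcube α i) g) x) ^ p * w x ≤
      apSup p w ^ p' * (ENNReal.ofReal p ^ p' * (ENNReal.ofReal p' ^ p *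
        ∫⁻ x, g x ^ p * w x)) := by
  have hp0 := hpp.pos
  have hp1 : 0 < p - 1 := by linarith [hpp.lt]
  have hfin := lerner_fin volume (dcube α) (dcube_meas α) (dcube_laminar α)
    (fun i => by rw [dcube_vol]; exact pow_ne_zero _ (by simp; positivity))
    (fun i => by rw [dcube_vol]; exact ENNReal.pow_ne_top ENNReal.ofReal_ne_top)
    p p' hpp w hw.1 hw.2 (apSup p w) hA ?_ g hg
  · have e : ∀ x, (⨆ i, (dcube α i).indicator (fun _ => avgE (dcube α i) g) x) ^ p * w x =
        ⨆ F : Finset (ℤ × (Fin n → ℤ)), finMax (dcube α)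
          (fun i => (∫⁻ y in dcube α i, g y) / volume (dcube α i)) F x ^ p * w x := by
      intro x
      rw [← ENNReal.iSup_mul]
      congr 1
      have := (ENNReal.orderIsoRpow p hp0).map_iSup (fun F : Finset (ℤ × (Fin n → ℤ)) =>
        finMax (dcube α) (fun i => (∫⁻ y in dcube α i, g y) / volume (dcube α i)) F x)
      simp only [ENNReal.orderIsoRpow_apply] at this
      rw [← this]
      congr 1
      rw [iSup_eq_iSup_finset]
      simp only [finMax, Finset.sup_eq_iSup]
      rfl
    simp only [e]
    rw [lintegral_iSup_directed]
    · exact iSup_le hfin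
    · intro F
      exact (((finMax_meas _ (dcube_meas α) _ F).pow_const _).mul hw.1).aemeasurable
    · refine Monotone.directed_le ?_
      intro F G hFG x
      simp only
      gcongr
      exact Finset.sup_mono hFG
  · intro i
    obtain ⟨P, hP, hsub, hvol⟩ := dcube_sub α i
    have h1 : avgE P w * (avgE P fun x => w x ^ (-(1 / (p - 1)))) ^ (p - 1) ≤ apSup p w := by
      unfold apSup
      exact le_iSup₂ (f := fun Q (_ : IsCube Q) =>
        avgE Q w * (avgE Q fun x => w x ^ (-(1 / (p - 1)))) ^ (p - 1)) P hP
    refine le_trans ?_ h1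
    unfold avgE
    rw [hvol]
    have h2 : ∀ u : (Fin n → ℝ) → ℝ≥0∞, ∫⁻ x in dcube α i, u x ≤ ∫⁻ x in P, u x :=
      fun u => lintegral_mono_set hsub
    gcongr

lemma main_bound {n : ℕ} (p p' : ℝ) (hpp : p.HolderConjugate p')
    (w : (Fin n → ℝ) → ℝ≥0∞) (hw : IsWeight w) (hA : apSup p w ≠ ∞)
    (f : (Fin n → ℝ) → ℝ≥0∞) :
    ∫⁻ x, maximalFn f x ^ p * w x ≤ ((3:ℝ≥0∞) ^ n) ^ p * (3 ^ n *
      (apSup p w ^ p' * (ENNReal.ofReal p ^ p' * (ENNReal.ofReal p' ^ p *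
        ∫⁻ x, f x ^ p * w x)))) := by
  have hp0 := hpp.pos
  have hex : ∀ αi : (Fin n → Fin 3) × (ℤ × (Fin n → ℤ)), ∃ g : (Fin n → ℝ) → ℝ≥0∞,
      Measurable g ∧ g ≤ f ∧ ∫⁻ x in dcube αi.1 αi.2, f x = ∫⁻ x in dcube αi.1 αi.2, g x :=
    fun αi => exists_measurable_le_lintegral_eq _ f
  choose G hGm hGf hGe using hex
  set g : (Fin n → ℝ) → ℝ≥0∞ := fun x => ⨆ αi, G αi x with hg
  have hgm : Measurable g := Measurable.iSup hGm
  have hgf : g ≤ f := fun x => iSup_le fun αi => hGf αi x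
  have hge : ∀ α i, avgE (dcube α i) f ≤ avgE (dcube α i) g := by
    intro α i
    unfold avgE
    rw [hGe (α, i)]
    gcongr with x
    exact le_iSup (fun αi => G αi x) (α, i)
  set D : (Fin n → Fin 3) → (Fin n → ℝ) → ℝ≥0∞ := fun α x =>
    ⨆ i, (dcube α i).indicator (fun _ => avgE (dcube α i) g) x with hD
  have hpt : ∀ x, maximalFn f x ^ p ≤ ((3:ℝ≥0∞) ^ n) ^ p * ∑ α, D α x ^ p := by
    intro x
    have h1 : maximalFn f x ≤ 3 ^ n * ⨆ α, D α x := by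
      unfold maximalFn
      refine iSup_le fun Q => iSup_le fun hQ => iSup_le fun hx => ?_
      obtain ⟨α, i, hsub, hvol, hv0, hvt⟩ := cube_cover Q hQ
      have h2 : avgE Q f ≤ 3 ^ n * avgE (dcube α i) f := by
        unfold avgE
        have hi : (volume Q)⁻¹ ≤ 3 ^ n * (volume (dcube α i))⁻¹ := by
          have : (volume (dcube α i)) / 3 ^ n ≤ volume Q := by
            rw [ENNReal.div_le_iff (by positivity) (by simp), mul_comm]
            exact hvol
          have := ENNReal.inv_le_inv.2 this
          rwa [ENNReal.inv_div (by simp) (by simp), div_eq_mul_inv] at this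
        calc _ ≤ (∫⁻ x in dcube α i, f x) * (3 ^ n * (volume (dcube α i))⁻¹) := by
              rw [div_eq_mul_inv]
              exact mul_le_mul' (lintegral_mono_set hsub) hi
          _ = _ := by rw [div_eq_mul_inv]; ring
      refine h2.trans ?_
      gcongr
      refine (hge α i).trans ?_
      refine le_trans ?_ (le_iSup (fun α => D α x) α)
      refine le_trans ?_ (le_iSup (fun i =>
        (dcube α i).indicator (fun _ => avgE (dcube α i) g) x) i)
      rw [Set.indicator_of_mem (hsub hx)]
    have h3 := ENNReal.rpow_le_rpow h1 hp0.le
    rw [ENNReal.mul_rpow_of_nonneg _ _ hp0.le] at h3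
    refine h3.trans ?_
    gcongr
    have := (ENNReal.orderIsoRpow p hp0).map_iSup (fun α => D α x)
    simp only [ENNReal.orderIsoRpow_apply] at this
    rw [this]
    exact iSup_le fun α => Finset.single_le_sum (f := fun α => D α x ^ p)
      (fun _ _ => zero_le) (Finset.mem_univ α)
  have hDm : ∀ α, Measurable fun x => D α x ^ p * w x := by
    intro α
    refine Measurable.mul (Measurable.pow_const (Measurable.iSup fun i => ?_) _) hw.1
    exact measurable_const.indicator (dcube_meas α i)
  calc _ ≤ ∫⁻ x, ((3:ℝ≥0∞) ^ n) ^ p * ∑ α, D α x ^ p * w x := by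
        refine lintegral_mono fun x => ?_
        rw [← Finset.sum_mul, ← mul_assoc]
        gcongr
        exact hpt x
    _ = ((3:ℝ≥0∞) ^ n) ^ p * ∑ α, ∫⁻ x, D α x ^ p * w x := by
        rw [lintegral_const_mul _ (Finset.measurable_fun_sum _ fun α _ => hDm α),
          lintegral_finsetSum _ fun α _ => hDm α]
    _ ≤ ((3:ℝ≥0∞) ^ n) ^ p * ∑ α : Fin n → Fin 3, (apSup p w ^ p' * (ENNReal.ofReal p ^ p' *
          (ENNReal.ofReal p' ^ p * ∫⁻ x, f x ^ p * w x))) := by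
        gcongr with α
        refine (dyadic_bound p p' hpp w hw hA g hgm α).trans ?_
        gcongr with x
        exact hgf x
    _ = _ := by
        simp

lemma zero_dim (p : ℝ) (hp : 1 < p)
    (w : (Fin 0 → ℝ) → ℝ≥0∞) (hw : IsWeight w) (f : (Fin 0 → ℝ) → ℝ≥0∞) :
    (∀ x, maximalFn f x ≤ f x) ∧ 1 ≤ apSup p w := by
  have hp1 : 0 < p - 1 := by linarith
  have hv : (volume : Measure (Fin 0 → ℝ)) Set.univ = 1 := by
    have := cube_vol (n := 0) (fun _ => 0) 1
    have e : {x : Fin 0 → ℝ | ∀ i, |x i - (fun _ => (0:ℝ)) i| ≤ 1} = Set.univ := by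
      ext x; simp
    rw [e] at this
    simpa using this
  have hcu : ∀ Q : Set (Fin 0 → ℝ), IsCube Q → Q = Set.univ := by
    rintro Q ⟨c, r, hr, rfl⟩
    ext x; simp
  have havg : ∀ u : (Fin 0 → ℝ) → ℝ≥0∞, ∀ x, avgE Set.univ u = u x := by
    intro u x
    unfold avgE
    rw [Measure.restrict_univ, lintegral_unique, hv, mul_one, div_one]
    exact congrArg u (Subsingleton.elim _ _)
  constructor
  · intro x
    unfold maximalFn
    refine iSup_le fun Q => iSup_le fun hQ => iSup_le fun _ => ?_
    rw [hcu Q hQ, havg f x]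
  · have hx : 0 < w default ∧ w default < ∞ := by
      obtain ⟨x, hx⟩ : ∃ x, 0 < w x ∧ w x < ∞ := by
        have : NeZero (volume : Measure (Fin 0 → ℝ)) := ⟨fun h => by simp [h] at hv⟩
        exact hw.2.exists
      rwa [Subsingleton.elim default x]
    have hc : IsCube (Set.univ : Set (Fin 0 → ℝ)) := ⟨fun _ => 0, 1, one_pos, by ext x; simp⟩
    have h1 : avgE Set.univ w * (avgE Set.univ fun x => w x ^ (-(1 / (p - 1)))) ^ (p - 1)
        ≤ apSup p w := by
      unfold apSup
      exact le_iSup₂ (f := fun Q (_ : IsCube Q) =>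
        avgE Q w * (avgE Q fun x => w x ^ (-(1 / (p - 1)))) ^ (p - 1)) Set.univ hc
    refine le_trans ?_ h1
    rw [havg w default, havg _ default, ← ENNReal.rpow_mul]
    rw [show -(1 / (p - 1)) * (p - 1) = -1 by field_simp, ENNReal.rpow_neg_one,
      ENNReal.mul_inv_cancel hx.1.ne' hx.2.ne]

/-- Buckley's sharp weighted bound with explicit constant:
`‖M‖_{L^p(w)→L^p(w)} ≤ 2^n 3^{n(p/(p-1)+6/p)} [w]_{A_p}^{1/(p-1)}` for `p ∈ (1,∞)`, `w ∈ A_p`. -/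
theorem statement6 {n : ℕ} (p : ℝ) (hp : 1 < p)
    (w : (Fin n → ℝ) → ℝ≥0∞) (hw : IsWeight w) (hA : apConst p w ≠ ∞) :
    ∀ f : (Fin n → ℝ) → ℝ≥0∞,
      (∫⁻ x, maximalFn f x ^ p * w x) ^ (1/p) ≤
        (2 : ℝ≥0∞) ^ (n : ℝ) * 3 ^ ((n : ℝ) * (p/(p-1) + 6/p)) *
          apConst p w ^ (1/(p-1)) * (∫⁻ x, f x ^ p * w x) ^ (1/p) := by
  intro f
  have hp0 : 0 < p := by linarith
  have hp1 : 0 < p - 1 := by linarith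
  have hAp : apConst p w = apSup p w := by
    unfold apConst
    rw [if_neg hp.ne']
  rw [hAp] at hA ⊢
  rcases Nat.eq_zero_or_pos n with rfl | hn
  · obtain ⟨h1, h2⟩ := zero_dim p hp w hw f
    have h3 : (∫⁻ x, maximalFn f x ^ p * w x) ^ (1/p) ≤ (∫⁻ x, f x ^ p * w x) ^ (1/p) := by
      gcongr with x
      exact h1 x
    refine h3.trans ?_
    have h4 : 1 ≤ apSup p w ^ (1/(p-1)) := ENNReal.one_le_rpow h2 (by positivity)
    simp only [Nat.cast_zero, ENNReal.rpow_zero, zero_mul, one_mul]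
    exact le_mul_of_one_le_left zero_le h4
  · have hpp : p.HolderConjugate (p / (p - 1)) := Real.HolderConjugate.conjExponent hp
    have hm := main_bound p _ hpp w hw hA f
    have hm2 := ENNReal.rpow_le_rpow hm (show 0 ≤ 1 / p by positivity)
    refine hm2.trans ?_
    have hi : (0:ℝ) ≤ 1 / p := by positivity
    have hpi : p * (1 / p) = 1 := by field_simp
    have hpi' : p / (p - 1) * (1 / p) = 1 / (p - 1) := by field_simp
    simp only [ENNReal.mul_rpow_of_nonneg _ _ hi, ← ENNReal.rpow_mul]
    rw [hpi, hpi', ENNReal.rpow_one, ENNReal.rpow_one]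
    have hc := enn_const p hp n hn.ne'
    have e3 : (3:ℝ≥0∞) ^ ((n : ℝ) * (p/(p-1) + 6/p)) =
        3 ^ n * ((3:ℝ≥0∞) ^ n) ^ (1/p) * 3 ^ ((n : ℝ) * (1 / (p - 1) + 5 / p)) := by
      rw [← ENNReal.rpow_natCast, ← ENNReal.rpow_mul,
        ← ENNReal.rpow_add _ _ (by norm_num) (by norm_num),
        ← ENNReal.rpow_add _ _ (by norm_num) (by norm_num)]
      congr 1
      field_simp
      ring
    rw [e3]
    calc _ = (3 ^ n * ((3:ℝ≥0∞) ^ n) ^ (1/p)) *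
          (ENNReal.ofReal p ^ (1 / (p - 1)) * ENNReal.ofReal (p / (p - 1))) *
          apSup p w ^ (1/(p-1)) * (∫⁻ x, f x ^ p * w x) ^ (1/p) := by ring
      _ ≤ (3 ^ n * ((3:ℝ≥0∞) ^ n) ^ (1/p)) *
          (2 ^ (n : ℝ) * 3 ^ ((n : ℝ) * (1 / (p - 1) + 5 / p))) *
          apSup p w ^ (1/(p-1)) * (∫⁻ x, f x ^ p * w x) ^ (1/p) := by gcongr
      _ = _ := by ring
end
end

section
/- Let $\varepsilon > 0$ and let $\{Q_j\}$ be a pairwise disjoint family of cubes in $\mathbb{R}^n$ with union $\Omega$. Define the Marcinkiewicz-type function $\mathfrak{M}_\varepsilon(x) := \sum_j \frac{\ell(Q_j)^{n+\varepsilon}}{|x - x_{Q_j}|^{n+\varepsilon} + \ell(Q_j)^{n+\varepsilon}}$, where $x_{Q_j}$ and $\ell(Q_j)$ are the center and sidelength of $Q_j$. Then for every weight $w \in A_2$, $\|\mathfrak{M}_\varepsilon\|_{L^2(w)} \le C_{n,\varepsilon} [w]_{A_2} \, w(\Omega)^{1/2}$. -/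
open MeasureTheory ENNReal

noncomputable section

/-- Centered maximal function over a countable set of radii. -/
def cMax {n : ℕ} (ρ : ℕ → ℝ) (μ : Measure (Fin n → ℝ)) (f : (Fin n → ℝ) → ℝ≥0∞)
    (x : Fin n → ℝ) : ℝ≥0∞ :=
  ⨆ i, (∫⁻ y in Metric.closedBall x (ρ i), f y ∂μ) / μ (Metric.closedBall x (ρ i))

theorem meas_ball {n : ℕ} (μ : Measure (Fin n → ℝ)) [SFinite μ] (r : ℝ) :
    Measurable fun x : Fin n → ℝ => μ (Metric.closedBall x r) := by
  have hs : MeasurableSet {p : (Fin n → ℝ) × (Fin n → ℝ) | dist p.2 p.1 ≤ r} :=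
    measurableSet_le (by fun_prop) (by fun_prop)
  exact measurable_measure_prodMk_left hs

theorem cMax_meas {n : ℕ} (ρ : ℕ → ℝ) (μ : Measure (Fin n → ℝ)) [SFinite μ]
    (f : (Fin n → ℝ) → ℝ≥0∞) : Measurable (cMax ρ μ f) := by
  refine Measurable.iSup fun i => ?_
  refine Measurable.div ?_ (meas_ball μ _)
  have := meas_ball (μ.withDensity f) (ρ i)
  simpa [withDensity_apply f Metric.isClosed_closedBall.measurableSet] using this
  

theorem cMax_weak_fin {n : ℕ} {N : ℕ} {τ : ℝ} (hτ : 1 < τ)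
    (hN : IsEmpty (Besicovitch.SatelliteConfig (Fin n → ℝ) N τ))
    (ρ : ℕ → ℝ) (hρ : ∀ i, 0 < ρ i) (μ : Measure (Fin n → ℝ))
    (f : (Fin n → ℝ) → ℝ≥0∞) (t : ℝ≥0∞) (m : ℕ) :
    t * μ {x | ∃ i ≤ m, t < (∫⁻ y in Metric.closedBall x (ρ i), f y ∂μ) /
      μ (Metric.closedBall x (ρ i))} ≤ N * ∫⁻ x, f x ∂μ := by
  set S := {x | ∃ i ≤ m, t < (∫⁻ y in Metric.closedBall x (ρ i), f y ∂μ) /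
      μ (Metric.closedBall x (ρ i))} with hS
  choose k hk1 hk2 using fun x : S => x.2
  let q : Besicovitch.BallPackage S (Fin n → ℝ) :=
    { c := fun x => x
      r := fun x => ρ (k x)
      rpos := fun x => hρ _
      r_bound := ∑ i ∈ Finset.range (m+1), ρ i
      r_le := fun x => Finset.single_le_sum (f := ρ) (fun i _ => (hρ i).le)
        (Finset.mem_range.2 (Nat.lt_succ_of_le (hk1 x))) }
  obtain ⟨s, hs1, hs2⟩ := Besicovitch.exist_disjoint_covering_families hτ hN q
  have hc : ∀ i, (s i).Countable := by
    intro i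
    refine (hs1 i).countable_of_nonempty_interior fun j _ => ?_
    have : (Metric.ball (q.c j) (q.r j)).Nonempty := Metric.nonempty_ball.2 (q.rpos _)
    exact this.mono Metric.ball_subset_interior_closedBall
  have hcov : S ⊆ ⋃ i : Fin N, ⋃ j ∈ s i, Metric.closedBall (q.c j) (q.r j) := by
    intro x hx
    have := hs2 ⟨⟨x, hx⟩, rfl⟩
    simp only [Set.mem_iUnion] at this ⊢
    obtain ⟨i, j, h, h'⟩ := this
    exact ⟨i, j, h, Metric.ball_subset_closedBall h'⟩
  calc t * μ S ≤ t * ∑ i : Fin N, ∑' j : s i, μ (Metric.closedBall (q.c j) (q.r j)) := by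
        gcongr
        refine (measure_mono hcov).trans ((measure_iUnion_fintype_le _ _).trans ?_)
        gcongr with i
        exact measure_biUnion_le μ (hc i) _
    _ = ∑ i : Fin N, ∑' j : s i, t * μ (Metric.closedBall (q.c j) (q.r j)) := by
        rw [Finset.mul_sum]
        simp_rw [ENNReal.tsum_mul_left]
    _ ≤ ∑ i : Fin N, ∑' j : s i, ∫⁻ x in Metric.closedBall (q.c j) (q.r j), f x ∂μ := by
        gcongr with i _ j
        exact ENNReal.mul_le_of_le_div (hk2 j.1).le
    _ = ∑ i : Fin N, ∫⁻ x in ⋃ j ∈ s i, Metric.closedBall (q.c j) (q.r j), f x ∂μ := by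
        refine Finset.sum_congr rfl fun i _ => ?_
        rw [lintegral_biUnion (hc i) (fun _ _ => Metric.isClosed_closedBall.measurableSet) (hs1 i)]
    _ ≤ ∑ i : Fin N, ∫⁻ x, f x ∂μ := by
        gcongr with i
        exact Measure.restrict_le_self
    _ = N * ∫⁻ x, f x ∂μ := by simp

theorem cMax_weak {n : ℕ} {N : ℕ} {τ : ℝ} (hτ : 1 < τ)
    (hN : IsEmpty (Besicovitch.SatelliteConfig (Fin n → ℝ) N τ))
    (ρ : ℕ → ℝ) (hρ : ∀ i, 0 < ρ i) (μ : Measure (Fin n → ℝ))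
    (f : (Fin n → ℝ) → ℝ≥0∞) (t : ℝ≥0∞) :
    t * μ {x | t < cMax ρ μ f x} ≤ N * ∫⁻ x, f x ∂μ := by
  have : {x | t < cMax ρ μ f x} = ⋃ m : ℕ, {x | ∃ i ≤ m, t <
      (∫⁻ y in Metric.closedBall x (ρ i), f y ∂μ) / μ (Metric.closedBall x (ρ i))} := by
    ext x
    simp only [cMax, Set.mem_ofPred_eq, lt_iSup_iff, Set.mem_iUnion]
    exact ⟨fun ⟨i, h⟩ => ⟨i, i, le_rfl, h⟩, fun ⟨_, i, _, h⟩ => ⟨i, h⟩⟩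
  rw [this, Monotone.measure_iUnion, ENNReal.mul_iSup]
  · exact iSup_le fun m => cMax_weak_fin hτ hN ρ hρ μ f t m
  · intro a b hab x ⟨i, hi, h⟩
    exact ⟨i, hi.trans hab, h⟩

theorem sq_le_layer (a : ℝ≥0∞) :
    a ^ 2 ≤ 4 * ∫⁻ t in Set.Ioi (0:ℝ), ENNReal.ofReal t *
      Set.indicator {t : ℝ | ENNReal.ofReal t < a} 1 t := by
  by_cases ha : a = ∞
  · subst ha
    have : ∫⁻ t in Set.Ioi (0:ℝ), ENNReal.ofReal t *
      Set.indicator {t : ℝ | ENNReal.ofReal t < ∞} 1 t = ∞ := by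
      rw [eq_top_iff]
      calc ∞ = ∫⁻ t in Set.Ioi (1:ℝ), 1 := by simp
        _ ≤ ∫⁻ t in Set.Ioi (1:ℝ), ENNReal.ofReal t *
              Set.indicator {t : ℝ | ENNReal.ofReal t < ∞} 1 t := by
          refine setLIntegral_mono' measurableSet_Ioi fun t ht => ?_
          have : (1:ℝ≥0∞) ≤ ENNReal.ofReal t := by
            rw [ENNReal.one_le_ofReal]; exact le_of_lt ht
          simpa using this
        _ ≤ _ := lintegral_mono_set (Set.Ioi_subset_Ioi zero_le_one)
    rw [this]; simp
  · lift a to NNReal using ha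
    calc (a:ℝ≥0∞) ^ 2 = 4 * ∫⁻ t in Set.Ioo ((a:ℝ)/2) a, ENNReal.ofReal (a/2) := by
          rw [setLIntegral_const, Real.volume_Ioo, ← ENNReal.ofReal_mul (by positivity),
            show (4:ℝ≥0∞) = ENNReal.ofReal 4 by norm_num, ← ENNReal.ofReal_mul (by positivity),
            ← ENNReal.ofReal_coe_nnreal, ← ENNReal.ofReal_pow (by positivity)]
          congr 1; ring
      _ ≤ 4 * ∫⁻ t in Set.Ioo ((a:ℝ)/2) a, ENNReal.ofReal t *
            Set.indicator {t : ℝ | ENNReal.ofReal t < a} 1 t := by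
          gcongr 4 * ?_
          refine setLIntegral_mono' measurableSet_Ioo fun t ht => ?_
          have h0 : 0 < t := lt_of_le_of_lt (by positivity) ht.1
          have : ENNReal.ofReal t < a := by
            rw [← ENNReal.ofReal_coe_nnreal]
            exact (ENNReal.ofReal_lt_ofReal_iff (h0.trans ht.2)).2 ht.2
          simp only [Set.indicator, Set.mem_ofPred_eq, this, if_true, Pi.one_apply, mul_one]
          exact ENNReal.ofReal_le_ofReal ht.1.le
      _ ≤ _ := by
          gcongr 4 * ?_
          refine lintegral_mono_set fun t ht => lt_of_le_of_lt (by positivity) ht.1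

theorem layer_le (a : ℝ≥0∞) :
    ∫⁻ t in Set.Ioi (0:ℝ), Set.indicator {t : ℝ | ENNReal.ofReal t < 2 * a} 1 t ≤ 2 * a := by
  by_cases ha : a = ∞
  · subst ha; simp
  · lift a to NNReal using ha
    have : {t : ℝ | ENNReal.ofReal t < 2 * a} ∩ Set.Ioi 0 ⊆ Set.Ioo (0:ℝ) (2 * a) := by
      intro t ⟨h, h0⟩
      refine ⟨h0, ?_⟩
      have h' : ENNReal.ofReal t < ((2 * a : NNReal) : ℝ≥0∞) := by simpa using h
      rw [← ENNReal.ofReal_coe_nnreal] at h'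
      have := (ENNReal.ofReal_lt_ofReal_iff_of_nonneg (le_of_lt h0)).1 h'
      simpa using this
    have hm : MeasurableSet {t : ℝ | ENNReal.ofReal t < 2 * a} :=
      measurableSet_lt (by fun_prop) (by fun_prop)
    rw [lintegral_indicator_one hm, Measure.restrict_apply hm]
    refine (measure_mono this).trans ?_
    rw [Real.volume_Ioo, sub_zero, ENNReal.ofReal_mul (by norm_num)]
    simp

theorem cMax_level {n : ℕ} {N : ℕ} {τ : ℝ} (hτ : 1 < τ)
    (hN : IsEmpty (Besicovitch.SatelliteConfig (Fin n → ℝ) N τ))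
    (ρ : ℕ → ℝ) (hρ : ∀ i, 0 < ρ i) (μ : Measure (Fin n → ℝ))
    (f : (Fin n → ℝ) → ℝ≥0∞) (hf : Measurable f) (t : ℝ) (ht : 0 < t) :
    ENNReal.ofReal t * μ {x | ENNReal.ofReal t < cMax ρ μ f x} ≤
      2 * N * ∫⁻ x, f x * Set.indicator {t : ℝ | ENNReal.ofReal t < 2 * f x} 1 t ∂μ := by
  set T := ENNReal.ofReal t with hT
  set g := fun x => f x * Set.indicator {t : ℝ | ENNReal.ofReal t < 2 * f x} 1 t with hg
  have hfg : ∀ x, f x ≤ g x + T / 2 := by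
    intro x
    by_cases h : T < 2 * f x
    · have : g x = f x := by simp [hg, ← hT, h]
      rw [this]; exact le_self_add
    · refine le_trans ?_ le_add_self
      rw [ENNReal.le_div_iff_mul_le (by simp) (by simp), mul_comm]
      exact not_lt.1 h
  have hM : ∀ x, cMax ρ μ f x ≤ cMax ρ μ g x + T / 2 := by
    intro x
    refine iSup_le fun i => ?_
    set B := Metric.closedBall x (ρ i)
    calc (∫⁻ y in B, f y ∂μ) / μ B ≤ (∫⁻ y in B, (g y + T/2) ∂μ) / μ B := by
          gcongr with y; exact hfg y
      _ = (∫⁻ y in B, g y ∂μ) / μ B + (T/2 * μ B) / μ B := by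
          rw [lintegral_add_right _ measurable_const, ENNReal.add_div, setLIntegral_const]
      _ ≤ cMax ρ μ g x + T / 2 := by
          refine add_le_add ?_ ?_
          · exact le_iSup (fun i => (∫⁻ y in Metric.closedBall x (ρ i), g y ∂μ) /
              μ (Metric.closedBall x (ρ i))) i
          · rw [mul_div_assoc]
            exact mul_le_of_le_one_right' ENNReal.div_self_le_one
  have hsub : {x | T < cMax ρ μ f x} ⊆ {x | T / 2 < cMax ρ μ g x} := by
    intro x hx
    by_contra h
    simp only [Set.mem_ofPred_eq, not_lt] at h hx
    have := (hM x).trans (add_le_add_left h (T/2))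
    rw [ENNReal.add_halves] at this
    exact absurd hx (not_lt.2 this)
  calc T * μ {x | T < cMax ρ μ f x} ≤ T * μ {x | T / 2 < cMax ρ μ g x} := by gcongr
    _ = 2 * (T / 2 * μ {x | T / 2 < cMax ρ μ g x}) := by
        rw [← mul_assoc, ENNReal.mul_div_cancel (by simp) (by simp)]
    _ ≤ 2 * (N * ∫⁻ x, g x ∂μ) := by
        gcongr 2 * ?_
        exact cMax_weak hτ hN ρ hρ μ g _
    _ = _ := by rw [mul_assoc]

theorem cMax_strong {n : ℕ} {N : ℕ} {τ : ℝ} (hτ : 1 < τ)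
    (hN : IsEmpty (Besicovitch.SatelliteConfig (Fin n → ℝ) N τ))
    (ρ : ℕ → ℝ) (hρ : ∀ i, 0 < ρ i) (μ : Measure (Fin n → ℝ)) [SFinite μ]
    (f : (Fin n → ℝ) → ℝ≥0∞) (hf : Measurable f) :
    ∫⁻ x, cMax ρ μ f x ^ 2 ∂μ ≤ 16 * N * ∫⁻ x, f x ^ 2 ∂μ := by
  have hMm := cMax_meas ρ μ f
  have hm1 : Measurable (Function.uncurry fun (x : Fin n → ℝ) (t : ℝ) => ENNReal.ofReal t *
      Set.indicator {t : ℝ | ENNReal.ofReal t < cMax ρ μ f x} 1 t) := by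
    refine Measurable.mul (by fun_prop) ?_
    have : MeasurableSet {p : (Fin n → ℝ) × ℝ | ENNReal.ofReal p.2 < cMax ρ μ f p.1} :=
      measurableSet_lt (by fun_prop) (by fun_prop)
    have h1 : Measurable (1 : (Fin n → ℝ) × ℝ → ℝ≥0∞) := measurable_one
    exact h1.indicator this
  have hm2 : Measurable (Function.uncurry fun (x : Fin n → ℝ) (t : ℝ) => f x *
      Set.indicator {t : ℝ | ENNReal.ofReal t < 2 * f x} 1 t) := by
    refine Measurable.mul (by fun_prop) ?_
    have : MeasurableSet {p : (Fin n → ℝ) × ℝ | ENNReal.ofReal p.2 < 2 * f p.1} :=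
      measurableSet_lt (by fun_prop) (by fun_prop)
    have h1 : Measurable (1 : (Fin n → ℝ) × ℝ → ℝ≥0∞) := measurable_one
    exact h1.indicator this
  calc ∫⁻ x, cMax ρ μ f x ^ 2 ∂μ
      ≤ ∫⁻ x, (4 * ∫⁻ t in Set.Ioi (0:ℝ), ENNReal.ofReal t *
          Set.indicator {t : ℝ | ENNReal.ofReal t < cMax ρ μ f x} 1 t) ∂μ :=
        lintegral_mono fun x => sq_le_layer _
    _ = 4 * ∫⁻ t in Set.Ioi (0:ℝ), ∫⁻ x, ENNReal.ofReal t *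
          Set.indicator {t : ℝ | ENNReal.ofReal t < cMax ρ μ f x} 1 t ∂μ := by
        rw [lintegral_const_mul' _ _ (by simp), lintegral_lintegral_swap hm1.aemeasurable]
    _ = 4 * ∫⁻ t in Set.Ioi (0:ℝ), ENNReal.ofReal t *
          μ {x | ENNReal.ofReal t < cMax ρ μ f x} := by
        congr 2; ext t
        rw [lintegral_const_mul' _ _ (by simp)]
        have : MeasurableSet {x | ENNReal.ofReal t < cMax ρ μ f x} :=
          measurableSet_lt (by fun_prop) (by fun_prop)
        rw [← lintegral_indicator_one this]
        rfl
    _ ≤ 4 * ∫⁻ t in Set.Ioi (0:ℝ), 2 * N * ∫⁻ x, f x *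
          Set.indicator {t : ℝ | ENNReal.ofReal t < 2 * f x} 1 t ∂μ := by
        gcongr 4 * ?_
        exact setLIntegral_mono' measurableSet_Ioi fun t ht =>
          cMax_level hτ hN ρ hρ μ f hf t ht
    _ = 4 * (2 * N * ∫⁻ x, (f x * ∫⁻ t in Set.Ioi (0:ℝ),
          Set.indicator {t : ℝ | ENNReal.ofReal t < 2 * f x} 1 t) ∂μ) := by
        rw [lintegral_const_mul' _ _ (by finiteness), ← lintegral_lintegral_swap hm2.aemeasurable]
        congr 3; ext x
        rw [lintegral_const_mul]
        exact measurable_one.indicator (measurableSet_lt (by fun_prop) (by fun_prop))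
    _ ≤ 4 * (2 * N * ∫⁻ x, f x * (2 * f x) ∂μ) := by
        gcongr with x
        exact layer_le _
    _ = 16 * N * ∫⁻ x, f x ^ 2 ∂μ := by
        have : ∀ x, f x * (2 * f x) = 2 * f x ^ 2 := fun x => by ring
        simp_rw [this]
        rw [lintegral_const_mul' _ _ (by simp)]
        ring

theorem cube_eq_ball {n : ℕ} (x : Fin n → ℝ) (r : ℝ) (hr : 0 ≤ r) :
    {y : Fin n → ℝ | ∀ i, |y i - x i| ≤ r} = Metric.closedBall x r := by
  ext y
  simp [dist_pi_le_iff hr, Real.dist_eq]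

theorem a2_ball {n : ℕ} (w : (Fin n → ℝ) → ℝ≥0∞) (x : Fin n → ℝ) (r : ℝ) (hr : 0 < r) :
    volume.withDensity w (Metric.closedBall x r) *
      volume.withDensity (fun y => (w y)⁻¹) (Metric.closedBall x r) ≤
      apConst 2 w * volume (Metric.closedBall x r) ^ 2 := by
  set B := Metric.closedBall x r with hB
  have hBm : MeasurableSet B := Metric.isClosed_closedBall.measurableSet
  have hc : IsCube B := ⟨x, r, hr, (cube_eq_ball x r hr.le).symm⟩
  have h1 : avgE B w * avgE B (fun y => (w y)⁻¹) ≤ apConst 2 w := by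
    have : apConst 2 w = apSup 2 w := by simp [apConst]
    rw [this, apSup]
    refine le_trans (le_of_eq ?_) (le_iSup₂ (f := fun (Q : Set (Fin n → ℝ)) (_ : IsCube Q) =>
      avgE Q w * (avgE Q fun x => w x ^ (-(1 / ((2:ℝ) - 1)))) ^ ((2:ℝ) - 1)) B hc)
    have h2 : (2:ℝ) - 1 = 1 := by norm_num
    simp only [h2, div_one, ENNReal.rpow_neg_one, ENNReal.rpow_one]
  rw [withDensity_apply _ hBm, withDensity_apply _ hBm]
  have hv0 : volume B ≠ 0 := (Metric.measure_closedBall_pos _ _ hr).ne'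
  have hvt : volume B ≠ ∞ := measure_closedBall_lt_top.ne
  calc _ = (avgE B w * volume B) * (avgE B (fun y => (w y)⁻¹) * volume B) := by
        rw [avgE, avgE, ENNReal.div_mul_cancel hv0 hvt, ENNReal.div_mul_cancel hv0 hvt]
    _ = avgE B w * avgE B (fun y => (w y)⁻¹) * volume B ^ 2 := by ring
    _ ≤ _ := by gcongr

theorem pos_ball {n : ℕ} (w : (Fin n → ℝ) → ℝ≥0∞) (hw : Measurable w)
    (hw0 : ∀ᵐ x ∂(volume : Measure (Fin n → ℝ)), w x ≠ 0) (x : Fin n → ℝ) (r : ℝ) (hr : 0 < r) :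
    volume.withDensity w (Metric.closedBall x r) ≠ 0 := by
  intro h
  have := (withDensity_apply_eq_zero' hw.aemeasurable).1 h
  have h2 : volume (Metric.closedBall x r) = 0 := by
    refine measure_mono_null (t := {x | ¬ w x ≠ 0} ∪ ({x | w x ≠ 0} ∩ Metric.closedBall x r)) ?_
      (measure_union_null hw0 this)
    intro y hy
    by_cases h : w y = 0
    · left; simpa using h
    · right; exact ⟨h, hy⟩
  exact (Metric.measure_closedBall_pos _ _ hr).ne' h2

theorem avg_mul {α : Type*} [MeasurableSpace α] (μ : Measure α) (f : α → ℝ≥0∞) (B : Set α)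
    (hB : μ B ≠ ∞) : ∫⁻ y in B, f y ∂μ = μ B * ((∫⁻ y in B, f y ∂μ) / μ B) := by
  by_cases h0 : μ B = 0
  · rw [h0, zero_mul]; exact setLIntegral_measure_zero _ _ h0
  · rw [ENNReal.mul_div_cancel h0 hB]

/-- Pointwise estimate. -/
theorem lerner {n : ℕ} (w : (Fin n → ℝ) → ℝ≥0∞) (hw : IsWeight w) (hA : apConst 2 w ≠ ∞)
    (ρ : ℕ → ℝ) (hρ : ∀ i, 0 < ρ i) (g : (Fin n → ℝ) → ℝ≥0∞)
    (x : Fin n → ℝ) (i : ℕ) :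
    ∫⁻ y in Metric.closedBall x (ρ i), g y ∂(volume.withDensity w) ≤
      apConst 2 w * ENNReal.ofReal ((18 * ρ i) ^ n) *
      cMax ρ (volume.withDensity fun y => (w y)⁻¹)
        (fun y => cMax (fun i => 2 * ρ i) (volume.withDensity w) g y * w y) x := by
  set μ := (volume : Measure (Fin n → ℝ)).withDensity w with hμ
  set ν := (volume : Measure (Fin n → ℝ)).withDensity fun y => (w y)⁻¹ with hν
  set R := ρ i with hR
  have hR0 : 0 < R := hρ i
  set G := cMax (fun i => 2 * ρ i) μ g with hG
  have hGm : Measurable G := cMax_meas _ _ _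
  have hwm := hw.1
  have hwi : Measurable fun y => (w y)⁻¹ := hwm.inv
  have hμ0 : ∀ y r, 0 < r → μ (Metric.closedBall y r) ≠ 0 := fun y r hr =>
    pos_ball w hwm (hw.2.mono fun z hz => hz.1.ne') y r hr
  have hν0 : ∀ y r, 0 < r → ν (Metric.closedBall y r) ≠ 0 := fun y r hr =>
    pos_ball _ hwi (hw.2.mono fun z hz => ENNReal.inv_ne_zero.2 hz.2.ne) y r hr
  have hprod : ∀ y r, 0 < r → μ (Metric.closedBall y r) * ν (Metric.closedBall y r) ≠ ∞ := by
    intro y r hr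
    refine ne_top_of_le_ne_top ?_ (a2_ball w y r hr)
    exact ENNReal.mul_ne_top hA (ENNReal.pow_ne_top measure_closedBall_lt_top.ne)
  have hμt : ∀ y r, 0 < r → μ (Metric.closedBall y r) ≠ ∞ := by
    intro y r hr h
    apply hprod y r hr
    rw [h, ENNReal.top_mul (hν0 y r hr)]
  have hνt : ∀ y r, 0 < r → ν (Metric.closedBall y r) ≠ ∞ := by
    intro y r hr h
    apply hprod y r hr
    rw [h, ENNReal.mul_top (hμ0 y r hr)]
  set B := Metric.closedBall x R with hB
  set B3 := Metric.closedBall x (3 * R) with hB3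
  have hBm : MeasurableSet B := Metric.isClosed_closedBall.measurableSet
  have hv0 : volume B ≠ 0 := (Metric.measure_closedBall_pos _ _ hR0).ne'
  have hvt : volume B ≠ ∞ := measure_closedBall_lt_top.ne
  set I := ∫⁻ y in B, g y ∂μ with hI
  have h1 : ∀ y ∈ B, I ≤ μ B3 * G y := by
    intro y hy
    have hy' : dist y x ≤ R := hy
    have hs1 : B ⊆ Metric.closedBall y (2 * R) :=
      Metric.closedBall_subset_closedBall' (by rw [dist_comm]; linarith)
    have hs2 : Metric.closedBall y (2 * R) ⊆ B3 :=
      Metric.closedBall_subset_closedBall' (by linarith)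
    calc I ≤ ∫⁻ z in Metric.closedBall y (2 * R), g z ∂μ := lintegral_mono_set hs1
      _ = μ (Metric.closedBall y (2 * R)) * _ := avg_mul μ g _ (hμt y _ (by linarith))
      _ ≤ μ B3 * G y := by
        refine mul_le_mul' (measure_mono hs2) ?_
        exact le_iSup (fun i => (∫⁻ z in Metric.closedBall y (2 * ρ i), g z ∂μ) /
              μ (Metric.closedBall y (2 * ρ i))) i
  have h2 : I * volume B ≤ μ B3 * ∫⁻ y in B, G y := by
    rw [← setLIntegral_const, ← lintegral_const_mul _ hGm]
    exact setLIntegral_mono' hBm h1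
  have h3 : ∫⁻ y in B, G y = ∫⁻ y in B, G y * w y ∂ν := by
    rw [hν, setLIntegral_withDensity_eq_setLIntegral_mul _ hwi (show Measurable fun y => G y * w y from hGm.mul hwm) hBm]
    refine lintegral_congr_ae (ae_restrict_of_ae (hw.2.mono fun z hz => ?_))
    simp only [Pi.mul_apply]
    rw [mul_comm, mul_assoc, ENNReal.mul_inv_cancel hz.1.ne' hz.2.ne, mul_one]
  have h4 : ∫⁻ y in B, G y * w y ∂ν ≤ ν B3 * cMax ρ ν (fun y => G y * w y) x := by
    rw [avg_mul ν _ B (hνt x R hR0)]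
    refine mul_le_mul' (measure_mono (Metric.closedBall_subset_closedBall (by linarith))) ?_
    exact le_iSup (fun i => (∫⁻ z in Metric.closedBall x (ρ i), G z * w z ∂ν) /
              ν (Metric.closedBall x (ρ i))) i
  set Hx := cMax ρ ν (fun y => G y * w y) x
  have h5 : I * volume B ≤ apConst 2 w * ENNReal.ofReal ((18 * R) ^ n) * Hx * volume B := by
    calc I * volume B ≤ μ B3 * (ν B3 * Hx) := h2.trans (by rw [h3]; gcongr)
      _ = μ B3 * ν B3 * Hx := by ring
      _ ≤ apConst 2 w * volume B3 ^ 2 * Hx := by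
        gcongr ?_ * Hx
        exact a2_ball w x (3 * R) (by linarith)
      _ = apConst 2 w * (ENNReal.ofReal ((18 * R) ^ n) * volume B) * Hx := by
        congr 2
        rw [hB3, hB, Real.volume_pi_closedBall _ hR0.le,
          Real.volume_pi_closedBall _ (by linarith), ← ENNReal.ofReal_pow (by positivity),
          ← ENNReal.ofReal_mul (by positivity)]
        simp only [Fintype.card_fin]
        rw [← mul_pow, ← pow_mul, mul_comm n 2, pow_mul]
        congr 2; ring
      _ = _ := by ring
  exact (ENNReal.mul_le_mul_iff_left hv0 hvt).1 h5

theorem loc_fin {n : ℕ} (w : (Fin n → ℝ) → ℝ≥0∞) (hw : IsWeight w) (hA : apConst 2 w ≠ ∞)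
    (y : Fin n → ℝ) (r : ℝ) (hr : 0 < r) :
    volume.withDensity w (Metric.closedBall y r) ≠ ∞ := by
  intro h
  have h1 := a2_ball w y r hr
  rw [h, ENNReal.top_mul (pos_ball (fun y => (w y)⁻¹) hw.1.inv
    (hw.2.mono fun z hz => ENNReal.inv_ne_zero.2 hz.2.ne) y r hr), top_le_iff] at h1
  exact ENNReal.mul_ne_top hA (ENNReal.pow_ne_top measure_closedBall_lt_top.ne) h1

theorem cs {α : Type*} [MeasurableSpace α] (μ : Measure α) (f g : α → ℝ≥0∞)
    (hf : AEMeasurable f μ) (hg : AEMeasurable g μ) :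
    ∫⁻ a, f a * g a ∂μ ≤ (∫⁻ a, f a ^ 2 ∂μ) ^ (1/2:ℝ) * (∫⁻ a, g a ^ 2 ∂μ) ^ (1/2:ℝ) := by
  have := ENNReal.lintegral_mul_le_Lp_mul_Lq μ Real.HolderConjugate.two_two hf hg
  simpa using this

theorem key_sum {n : ℕ} {N : ℕ} {τ : ℝ} (hτ : 1 < τ)
    (hN : IsEmpty (Besicovitch.SatelliteConfig (Fin n → ℝ) N τ))
    (w : (Fin n → ℝ) → ℝ≥0∞) (hw : IsWeight w)
    (ρ : ℕ → ℝ) (hρ : ∀ i, 0 < ρ i) (g : (Fin n → ℝ) → ℝ≥0∞) (hg : Measurable g)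
    (Ω : Set (Fin n → ℝ)) (hΩ : MeasurableSet Ω) :
    ∫⁻ x in Ω, cMax ρ (volume.withDensity fun y => (w y)⁻¹)
        (fun y => cMax (fun i => 2 * ρ i) (volume.withDensity w) g y * w y) x ≤
      (16 * N) * (∫⁻ x in Ω, w x) ^ (1/2:ℝ) * (∫⁻ x, g x ^ 2 * w x) ^ (1/2:ℝ) := by
  set μ := (volume : Measure (Fin n → ℝ)).withDensity w with hμ
  set ν := (volume : Measure (Fin n → ℝ)).withDensity fun y => (w y)⁻¹ with hν
  set G := cMax (fun i => 2 * ρ i) μ g with hG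
  have hGm : Measurable G := cMax_meas _ _ _
  have hwm := hw.1
  have hwi : Measurable fun y => (w y)⁻¹ := hwm.inv
  set H := cMax ρ ν (fun y => G y * w y) with hH
  have hHm : Measurable H := cMax_meas _ _ _
  have e1 : ∫⁻ x in Ω, H x = ∫⁻ x in Ω, w x * H x ∂ν := by
    rw [hν, setLIntegral_withDensity_eq_setLIntegral_mul _ hwi (show Measurable fun y => w y * H y from hwm.mul hHm) hΩ]
    refine lintegral_congr_ae (ae_restrict_of_ae (hw.2.mono fun z hz => ?_))
    simp only [Pi.mul_apply]
    rw [← mul_assoc, ENNReal.inv_mul_cancel hz.1.ne' hz.2.ne, one_mul]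
  have e2 : ∫⁻ x in Ω, w x ^ 2 ∂ν = ∫⁻ x in Ω, w x := by
    rw [hν, setLIntegral_withDensity_eq_setLIntegral_mul _ hwi (hwm.pow_const 2) hΩ]
    refine lintegral_congr_ae (ae_restrict_of_ae (hw.2.mono fun z hz => ?_))
    simp only [Pi.mul_apply]
    rw [pow_two, ← mul_assoc, ENNReal.inv_mul_cancel hz.1.ne' hz.2.ne, one_mul]
  have e3 : ∫⁻ x in Ω, H x ^ 2 ∂ν ≤ (16 * N) ^ 2 * ∫⁻ x, g x ^ 2 * w x := by
    calc ∫⁻ x in Ω, H x ^ 2 ∂ν ≤ ∫⁻ x, H x ^ 2 ∂ν := setLIntegral_le_lintegral _ _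
      _ ≤ 16 * N * ∫⁻ x, (G x * w x) ^ 2 ∂ν :=
        cMax_strong hτ hN ρ hρ ν _ (hGm.mul hwm)
      _ = 16 * N * ∫⁻ x, G x ^ 2 ∂μ := by
        congr 1
        rw [hμ, hν, lintegral_withDensity_eq_lintegral_mul _ hwm (hGm.pow_const 2),
          lintegral_withDensity_eq_lintegral_mul _ hwi
            (show Measurable fun y => (G y * w y) ^ 2 from (hGm.mul hwm).pow_const 2)]
        refine lintegral_congr_ae (hw.2.mono fun z hz => ?_)
        simp only [Pi.mul_apply]
        calc (w z)⁻¹ * (G z * w z) ^ 2 = ((w z)⁻¹ * w z) * (w z * G z ^ 2) := by ring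
          _ = _ := by rw [ENNReal.inv_mul_cancel hz.1.ne' hz.2.ne, one_mul]
      _ ≤ 16 * N * (16 * N * ∫⁻ x, g x ^ 2 ∂μ) := by
        gcongr 16 * N * ?_
        exact cMax_strong hτ hN (fun i => 2 * ρ i) (fun i => by have := hρ i; positivity) μ _ hg
      _ = (16 * N) ^ 2 * ∫⁻ x, g x ^ 2 * w x := by
        rw [hμ, lintegral_withDensity_eq_lintegral_mul _ hwm (hg.pow_const 2), pow_two]
        simp only [Pi.mul_apply, mul_comm (w _)]
        ring
  rw [e1]
  refine (cs _ _ _ hwm.aemeasurable hHm.aemeasurable).trans ?_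
  rw [e2]
  calc _ ≤ (∫⁻ x in Ω, w x) ^ (1/2:ℝ) * ((16 * N) ^ 2 * ∫⁻ x, g x ^ 2 * w x) ^ (1/2:ℝ) := by
        gcongr
    _ = _ := by
        rw [ENNReal.mul_rpow_of_nonneg _ _ (by norm_num), ← ENNReal.rpow_natCast,
          ← ENNReal.rpow_mul]
        norm_num
        ring

theorem kernel_bd (s : ℝ) (hs : 0 < s) (d l : ℝ) (hd : 0 ≤ d) (hl : 0 < l) :
    ENNReal.ofReal (l ^ s / (d ^ s + l ^ s)) ≤
      ∑' k : ℕ, ENNReal.ofReal (2 ^ s * ((2:ℝ) ^ (-s)) ^ k) *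
        Set.indicator {d : ℝ | d ≤ 2 ^ k * l} 1 d := by
  have hex : ∃ k : ℕ, d ≤ 2 ^ k * l := by
    obtain ⟨k, hk⟩ := pow_unbounded_of_one_lt (d / l) (one_lt_two (α := ℝ))
    exact ⟨k, by rw [div_lt_iff₀ hl] at hk; exact hk.le⟩
  classical
  let k := Nat.find hex
  have hk : d ≤ 2 ^ k * l := Nat.find_spec hex
  refine le_trans ?_ (ENNReal.le_tsum k)
  have hls : 0 < l ^ s := Real.rpow_pos_of_pos hl s
  have hds : 0 ≤ d ^ s := Real.rpow_nonneg hd s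
  have h2 : 1 ≤ (2:ℝ) ^ s := Real.one_le_rpow one_le_two hs.le
  simp only [Set.indicator, Set.mem_ofPred_eq, hk, if_true, Pi.one_apply, mul_one]
  refine ENNReal.ofReal_le_ofReal ?_
  rcases Nat.eq_zero_or_pos k with h0 | hpos
  · rw [h0, pow_zero, mul_one]
    refine le_trans ?_ h2
    rw [div_le_one (by positivity)]; linarith
  · obtain ⟨m, hm⟩ : ∃ m, k = m + 1 := ⟨k - 1, by omega⟩
    have hlt : ¬ d ≤ 2 ^ m * l := Nat.find_min hex (by change m < k; omega)
    push Not at hlt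
    have h3 : (2 ^ m * l) ^ s ≤ d ^ s := Real.rpow_le_rpow (by positivity) hlt.le hs.le
    rw [Real.mul_rpow (by positivity) hl.le] at h3
    have h4 : (2:ℝ) ^ s * ((2:ℝ) ^ (-s)) ^ k = (((2:ℝ) ^ m) ^ s)⁻¹ := by
      rw [hm, pow_succ', ← mul_assoc, Real.rpow_neg (by norm_num), mul_inv_cancel₀ (by positivity),
        one_mul, inv_pow, ← Real.rpow_natCast, ← Real.rpow_mul (by norm_num),
        ← Real.rpow_natCast, ← Real.rpow_mul (by norm_num), mul_comm]
    rw [h4, div_le_iff₀ (by positivity), inv_mul_eq_div, le_div_iff₀ (by positivity)]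
    nlinarith

theorem dual_bd {n : ℕ} (ε : ℝ) (hε : 0 < ε) (c : ℕ → (Fin n → ℝ)) (l : ℕ → ℝ)
    (hl : ∀ j, 0 < l j)
    (hd : Pairwise fun i j => Disjoint (Metric.closedBall (c i) (l i / 2))
      (Metric.closedBall (c j) (l j / 2)))
    (w : (Fin n → ℝ) → ℝ≥0∞) (hw : IsWeight w) (hA : apConst 2 w ≠ ∞)
    (g : (Fin n → ℝ) → ℝ≥0∞) (hg : Measurable g) :
    ∃ ρ : ℕ → ℝ, (∀ i, 0 < ρ i) ∧
    ∫⁻ x, (∑' j, ENNReal.ofReal (l j ^ ((n : ℝ) + ε) /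
        (‖x - c j‖ ^ ((n : ℝ) + ε) + l j ^ ((n : ℝ) + ε)))) * g x ∂(volume.withDensity w) ≤
      (∑' k : ℕ, ENNReal.ofReal (2 ^ ((n:ℝ) + ε) * 36 ^ n * ((2:ℝ) ^ (-ε)) ^ k)) * apConst 2 w *
      ∫⁻ x in ⋃ j, Metric.closedBall (c j) (l j / 2),
        cMax ρ (volume.withDensity fun y => (w y)⁻¹)
        (fun y => cMax (fun i => 2 * ρ i) (volume.withDensity w) g y * w y) x := by
  set s := (n:ℝ) + ε with hs
  have hs0 : 0 < s := by positivity
  let ρ : ℕ → ℝ := fun m => 2 ^ ((Nat.unpair m).2 + 1) * l (Nat.unpair m).1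
  have hρ : ∀ i, 0 < ρ i := fun i => mul_pos (by positivity) (hl _)
  refine ⟨ρ, hρ, ?_⟩
  set μ := (volume : Measure (Fin n → ℝ)).withDensity w with hμ
  set H := cMax ρ (volume.withDensity fun y => (w y)⁻¹)
        (fun y => cMax (fun i => 2 * ρ i) μ g y * w y) with hH
  have hHm : Measurable H := cMax_meas _ _ _
  have hI : ∀ j k : ℕ, ∫⁻ y in Metric.closedBall (c j) (2 ^ k * l j), g y ∂μ ≤
      apConst 2 w * ENNReal.ofReal ((36 * 2 ^ k) ^ n) *
        ∫⁻ x in Metric.closedBall (c j) (l j / 2), H x := by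
    intro j k
    have hlj := hl j
    set Q := Metric.closedBall (c j) (l j / 2) with hQ
    have hQm : MeasurableSet Q := Metric.isClosed_closedBall.measurableSet
    have hv : volume Q = ENNReal.ofReal (l j ^ n) := by
      rw [hQ, Real.volume_pi_closedBall _ (by positivity), Fintype.card_fin]
      congr 2; ring
    have hv0 : volume Q ≠ 0 := (Metric.measure_closedBall_pos _ _ (by positivity)).ne'
    have hvt : volume Q ≠ ∞ := measure_closedBall_lt_top.ne
    set I := ∫⁻ y in Metric.closedBall (c j) (2 ^ k * l j), g y ∂μ with hI
    have hr : ρ (Nat.pair j k) = 2 ^ (k + 1) * l j := by simp [ρ]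
    have h1 : ∀ x ∈ Q, I ≤ apConst 2 w * ENNReal.ofReal ((36 * 2 ^ k) ^ n) * volume Q * H x := by
      intro x hx
      have hx' : dist x (c j) ≤ l j / 2 := hx
      have h2k : (1:ℝ) ≤ 2 ^ k := one_le_pow₀ one_le_two
      have hsub : Metric.closedBall (c j) (2 ^ k * l j) ⊆
          Metric.closedBall x (ρ (Nat.pair j k)) := by
        refine Metric.closedBall_subset_closedBall' ?_
        rw [hr, dist_comm, pow_succ]
        nlinarith
      refine (lintegral_mono_set hsub).trans ((lerner w hw hA ρ hρ g x _).trans (le_of_eq ?_))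
      rw [mul_assoc (apConst 2 w) _ (volume Q), hv, ← ENNReal.ofReal_mul (by positivity), hr,
        ← mul_pow]
      congr 4; ring
    have h2 : I * volume Q ≤ apConst 2 w * ENNReal.ofReal ((36 * 2 ^ k) ^ n) * (∫⁻ x in Q, H x)
        * volume Q := by
      calc I * volume Q ≤ apConst 2 w * ENNReal.ofReal ((36 * 2 ^ k) ^ n) * volume Q *
            ∫⁻ x in Q, H x := by
            rw [← setLIntegral_const, ← lintegral_const_mul _ hHm]
            exact setLIntegral_mono' hQm h1
        _ = _ := by ring
    exact (ENNReal.mul_le_mul_iff_left hv0 hvt).1 h2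
  have hbm : ∀ j (k : ℕ), MeasurableSet (Metric.closedBall (c j) (2 ^ k * l j)) :=
    fun j k => Metric.isClosed_closedBall.measurableSet
  set a : ℕ → ℝ≥0∞ := fun k => ENNReal.ofReal (2 ^ s * ((2:ℝ) ^ (-s)) ^ k) with ha
  calc ∫⁻ x, (∑' j, ENNReal.ofReal (l j ^ s / (‖x - c j‖ ^ s + l j ^ s))) * g x ∂μ
      ≤ ∫⁻ x, ∑' j, ∑' k : ℕ, a k *
          Set.indicator (Metric.closedBall (c j) (2 ^ k * l j)) g x ∂μ := by
        refine lintegral_mono fun x => ?_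
        rw [← ENNReal.tsum_mul_right]
        refine ENNReal.tsum_le_tsum fun j => ?_
        refine (mul_le_mul_left (kernel_bd s hs0 ‖x - c j‖ (l j) (norm_nonneg _) (hl j)) _).trans ?_
        rw [← ENNReal.tsum_mul_right]
        refine ENNReal.tsum_le_tsum fun k => ?_
        rw [mul_assoc]
        refine mul_le_mul_right (le_of_eq ?_) _
        by_cases h : ‖x - c j‖ ≤ 2 ^ k * l j
        · simp [Set.indicator, h, dist_eq_norm]
        · simp [Set.indicator, h, dist_eq_norm]
    _ = ∑' j, ∑' k : ℕ, a k * ∫⁻ x in Metric.closedBall (c j) (2 ^ k * l j), g x ∂μ := by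
        rw [lintegral_tsum]
        · congr 1; ext j
          rw [lintegral_tsum]
          · congr 1; ext k
            rw [lintegral_const_mul _ (hg.indicator (hbm j k)), lintegral_indicator (hbm j k)]
          · intro k
            exact ((hg.indicator (hbm j k)).const_mul _).aemeasurable
        · intro j
          exact (Measurable.tsum fun k => (hg.indicator (hbm j k)).const_mul _).aemeasurable
    _ ≤ ∑' j, ∑' k : ℕ, a k * (apConst 2 w * ENNReal.ofReal ((36 * 2 ^ k) ^ n) *
        ∫⁻ x in Metric.closedBall (c j) (l j / 2), H x) := by
        refine ENNReal.tsum_le_tsum fun j => ENNReal.tsum_le_tsum fun k => ?_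
        exact mul_le_mul_right (hI j k) _
    _ = ∑' j, ∑' k : ℕ, ENNReal.ofReal (2 ^ s * 36 ^ n * ((2:ℝ) ^ (-ε)) ^ k) * (apConst 2 w *
        ∫⁻ x in Metric.closedBall (c j) (l j / 2), H x) := by
        congr 1; ext j; congr 1; ext k
        have : ENNReal.ofReal (2 ^ s * 36 ^ n * ((2:ℝ) ^ (-ε)) ^ k) =
            a k * ENNReal.ofReal ((36 * 2 ^ k) ^ n) := by
          rw [ha, ← ENNReal.ofReal_mul (by positivity)]
          congr 1
          have h1 : (2:ℝ) ^ (-ε) = 2 ^ (-s) * 2 ^ n := by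
            rw [← Real.rpow_natCast, ← Real.rpow_add (by norm_num)]
            congr 1; rw [hs]; ring
          rw [h1]
          ring
        rw [this]; ring
    _ = _ := by
        simp_rw [ENNReal.tsum_mul_right]
        rw [ENNReal.tsum_mul_left, ENNReal.tsum_mul_left, ← mul_assoc,
          lintegral_iUnion (fun j => Metric.isClosed_closedBall.measurableSet) hd]

theorem ofReal_tsum_le (f : ℕ → ℝ) (hf : ∀ j, 0 ≤ f j) :
    ENNReal.ofReal (∑' j, f j) ≤ ∑' j, ENNReal.ofReal (f j) := by
  by_cases h : Summable f
  · rw [ENNReal.ofReal_tsum_of_nonneg hf h]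
  · rw [tsum_eq_zero_of_not_summable h]; simp

/-- Self-improvement: passing from the dual estimate to the norm estimate. -/
theorem dual_to_norm {n : ℕ} (w F : (Fin n → ℝ) → ℝ≥0∞) (hw : IsWeight w)
    (hA : apConst 2 w ≠ ∞) (hF : Measurable F) (D : ℝ≥0∞)
    (h : ∀ g : (Fin n → ℝ) → ℝ≥0∞, Measurable g →
      ∫⁻ x, F x * g x ∂(volume.withDensity w) ≤ D * (∫⁻ x, g x ^ 2 * w x) ^ (1/2:ℝ)) :
    (∫⁻ x, F x ^ 2 * w x) ^ (1/2:ℝ) ≤ D := by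
  set μ := (volume : Measure (Fin n → ℝ)).withDensity w with hμ
  let g : ℕ → (Fin n → ℝ) → ℝ≥0∞ := fun m =>
    Set.indicator (Metric.closedBall 0 (m + 1)) fun x => min (F x) m
  have hgm : ∀ m, Measurable (g m) := fun m =>
    (hF.min measurable_const).indicator Metric.isClosed_closedBall.measurableSet
  have hgF : ∀ m x, g m x ≤ F x := fun m x =>
    Set.indicator_le_self' (fun _ _ => zero_le) x |>.trans (min_le_left _ _)
  have hgint : ∀ f : (Fin n → ℝ) → ℝ≥0∞, Measurable f →
      ∫⁻ x, f x ^ 2 * w x = ∫⁻ x, f x ^ 2 ∂μ := by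
    intro f hf
    rw [hμ, lintegral_withDensity_eq_lintegral_mul _ hw.1 (hf.pow_const 2)]
    simp only [Pi.mul_apply, mul_comm]
  have hstep : ∀ m, (∫⁻ x, g m x ^ 2 ∂μ) ^ (1/2:ℝ) ≤ D := by
    intro m
    have hfin : ∫⁻ x, g m x ^ 2 ∂μ ≠ ∞ := by
      have : ∫⁻ x, g m x ^ 2 ∂μ ≤ ∫⁻ x in Metric.closedBall 0 (m + 1), (m:ℝ≥0∞) ^ 2 ∂μ := by
        rw [← lintegral_indicator Metric.isClosed_closedBall.measurableSet]
        refine lintegral_mono fun x => ?_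
        by_cases hx : x ∈ Metric.closedBall (0 : Fin n → ℝ) (m + 1)
        · simp only [g, Set.indicator_of_mem hx]
          gcongr; exact min_le_right _ _
        · simp only [g, Set.indicator_of_notMem hx]; simp
      refine ne_top_of_le_ne_top ?_ this
      rw [setLIntegral_const]
      exact ENNReal.mul_ne_top (by finiteness) (loc_fin w hw hA 0 _ (by positivity))
    set X := ∫⁻ x, g m x ^ 2 ∂μ with hX
    have h1 : X ≤ D * X ^ (1/2:ℝ) := by
      have := h (g m) (hgm m)
      rw [hgint _ (hgm m)] at this
      refine le_trans (lintegral_mono fun x => ?_) this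
      rw [pow_two]
      exact mul_le_mul_left (hgF m x) _
    by_cases h0 : X = 0
    · rw [h0]; simp
    · have hne : X ^ (1/2:ℝ) ≠ 0 := by simp [h0]
      have hnt : X ^ (1/2:ℝ) ≠ ∞ := by simp [hfin]
      refine (ENNReal.mul_le_mul_iff_left hne hnt).1 (le_trans (le_of_eq ?_) h1)
      rw [← ENNReal.rpow_add _ _ h0 hfin]; norm_num
  have hlim : ∫⁻ x, F x ^ 2 ∂μ = ⨆ m, ∫⁻ x, g m x ^ 2 ∂μ := by
    have hmono : ∀ x, Monotone fun m => g m x := by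
      intro x a b hab
      have hab' : (a:ℝ) ≤ b := by exact_mod_cast hab
      have hsub : Metric.closedBall (0 : Fin n → ℝ) (a + 1) ⊆ Metric.closedBall 0 (b + 1) :=
        Metric.closedBall_subset_closedBall (by linarith)
      by_cases hx : x ∈ Metric.closedBall (0 : Fin n → ℝ) (a + 1)
      · simp only [g, Set.indicator_of_mem hx, Set.indicator_of_mem (hsub hx)]
        gcongr
      · simp only [g, Set.indicator_of_notMem hx]; exact zero_le
    rw [← lintegral_iSup (fun m => (hgm m).pow_const 2)
      (fun a b hab x => pow_le_pow_left' (hmono x hab) 2)]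
    congr 1; ext x
    have hlimx : Filter.Tendsto (fun m => g m x) Filter.atTop (nhds (F x)) := by
      have h1 : Filter.Tendsto (fun m : ℕ => min (F x) (m:ℝ≥0∞)) Filter.atTop (nhds (F x)) := by
        have := (tendsto_const_nhds (x := F x)).min ENNReal.tendsto_nat_nhds_top
        simpa using this
      refine h1.congr' ?_
      obtain ⟨K, hK⟩ := exists_nat_ge ‖x‖
      filter_upwards [Filter.eventually_ge_atTop K] with m hm
      have hx : x ∈ Metric.closedBall (0 : Fin n → ℝ) (m + 1) := by
        have : (K:ℝ) ≤ m := by exact_mod_cast hm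
        simp only [Metric.mem_closedBall, dist_zero_right]; linarith
      simp only [g, Set.indicator_of_mem hx]
    have h2 : Filter.Tendsto (fun m => g m x ^ 2) Filter.atTop (nhds (F x ^ 2)) :=
      ENNReal.Tendsto.pow hlimx
    exact tendsto_nhds_unique h2
      (tendsto_atTop_iSup fun a b hab => pow_le_pow_left' (hmono x hab) 2)
  simp only [one_div] at hstep ⊢
  rw [hgint F hF, hlim, ENNReal.rpow_inv_le_iff (by norm_num)]
  exact iSup_le fun m => (ENNReal.rpow_inv_le_iff (by norm_num)).1 (hstep m)

/-- For a pairwise disjoint family of cubes `{Q_j}` (with centers `c j`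
and sidelengths `l j`) with union `Ω`, the Marcinkiewicz-type function
`𝔐_ε(x) = ∑_j l_j^{n+ε}/(|x-c_j|^{n+ε} + l_j^{n+ε})` satisfies
`‖𝔐_ε‖_{L²(w)} ≤ C_{n,ε} [w]_{A_2} w(Ω)^{1/2}` for every `w ∈ A_2`. -/
theorem statement14 {n : ℕ} (ε : ℝ) (hε : 0 < ε) :
    ∃ C : ℝ≥0∞, C ≠ ∞ ∧
      ∀ (c : ℕ → (Fin n → ℝ)) (l : ℕ → ℝ), (∀ j, 0 < l j) →
        (Pairwise fun i j =>
          Disjoint {x : Fin n → ℝ | ∀ k, |x k - c i k| ≤ l i / 2}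
            {x : Fin n → ℝ | ∀ k, |x k - c j k| ≤ l j / 2}) →
        ∀ w : (Fin n → ℝ) → ℝ≥0∞, IsWeight w → apConst 2 w ≠ ∞ →
          (∫⁻ x, ENNReal.ofReal
              (∑' j, l j ^ ((n : ℝ) + ε) /
                (‖x - c j‖ ^ ((n : ℝ) + ε) + l j ^ ((n : ℝ) + ε))) ^ (2 : ℝ) * w x)
            ^ (1/2 : ℝ) ≤
          C * apConst 2 w *
            (∫⁻ x in ⋃ j, {x : Fin n → ℝ | ∀ k, |x k - c j k| ≤ l j / 2}, w x) ^ (1/2 : ℝ) := by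
  obtain ⟨N, τ, hτ, hN⟩ :=
    HasBesicovitchCovering.no_satelliteConfig (α := Fin n → ℝ)
  refine ⟨(∑' k : ℕ, ENNReal.ofReal (2 ^ ((n:ℝ) + ε) * 36 ^ n * ((2:ℝ) ^ (-ε)) ^ k)) * (16 * N),
    ?_, ?_⟩
  · refine ENNReal.mul_ne_top ?_ (by finiteness)
    refine Summable.tsum_ofReal_ne_top ?_
    refine Summable.mul_left _ (summable_geometric_of_lt_one (by positivity) ?_)
    exact Real.rpow_lt_one_of_one_lt_of_neg one_lt_two (by linarith)
  · intro c l hl hd w hw hA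
    have hcube : ∀ j, {x : Fin n → ℝ | ∀ k, |x k - c j k| ≤ l j / 2} =
        Metric.closedBall (c j) (l j / 2) := fun j =>
      cube_eq_ball _ _ (by have := hl j; positivity)
    simp only [hcube] at hd ⊢
    set F : (Fin n → ℝ) → ℝ≥0∞ := fun x => ∑' j, ENNReal.ofReal (l j ^ ((n : ℝ) + ε) /
        (‖x - c j‖ ^ ((n : ℝ) + ε) + l j ^ ((n : ℝ) + ε))) with hF
    have hFm : Measurable F := Measurable.tsum fun j => by fun_prop
    have hΩ : MeasurableSet (⋃ j, Metric.closedBall (c j) (l j / 2)) :=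
      MeasurableSet.iUnion fun j => Metric.isClosed_closedBall.measurableSet
    refine le_trans ?_ (dual_to_norm w F hw hA hFm _ ?_)
    · refine ENNReal.rpow_le_rpow (lintegral_mono fun x => ?_) (by norm_num)
      rw [ENNReal.rpow_two]
      gcongr
      refine ofReal_tsum_le _ fun j => ?_
      have := hl j
      positivity
    · intro g hg
      obtain ⟨ρ, hρ, h⟩ := dual_bd ε hε c l hl hd w hw hA g hg
      refine h.trans ?_
      refine (mul_le_mul_right (key_sum hτ hN w hw ρ hρ g hg _ hΩ) _).trans (le_of_eq ?_)
      ring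
end
end
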